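/- Let d ≥ 2 and p ∈ [2, ∞). There exists a constant C(d, p) ≥ 1 such that for every sequence (c_n)_{n∈ℕ} of nonnegative reals: ‖ √( ∑_{n≥0} c_n² · e_d(n, x) / D(d,n) ) ‖_{L^p_x(ℝ^d)} ≤ C(d,p) · ( ∑_{n≥0} (1+n)^{−d(1/2 − 1/p)} c_n² )^{1/2}. In particular, if ∑_n (1+n)^{−d(1/2−1/p)} c_n² < ∞ then x ↦ √(∑_n c_n² e_d(n,x)/D(d,n)) belongs to L^p(ℝ^d) (the probabilistic Sobolev embedding ℋ^{−d(1/2−1/p)}(ℝ^d) ⊂ PL^p(ℝ^d, ⊕E_{d,n}) for the harmonic oscillator). -/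

import Mathlib

open MeasureTheory
open scoped ENNReal NNReal

/-- The `n`-th physicists' Hermite polynomial `H_n(x) = (−1)^n e^{x²} (d/dx)^n e^{−x²}`. -/
noncomputable def hermitePoly (n : ℕ) (x : ℝ) : ℝ :=
  (-1 : ℝ) ^ n * Real.exp (x ^ 2) * iteratedDeriv n (fun t => Real.exp (-t ^ 2)) x

/-- The `n`-th (L²-normalized) Hermite function
`h_n(x) = H_n(x) e^{−x²/2} / √(n! 2^n √π)`. -/
noncomputable def hermiteFun (n : ℕ) (x : ℝ) : ℝ :=
  hermitePoly n x * Real.exp (-x ^ 2 / 2) /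
    Real.sqrt ((n.factorial : ℝ) * 2 ^ n * Real.sqrt Real.pi)

/-- The spectral function of the `n`-th eigenspace of the harmonic oscillator `−Δ + |x|²`
on `ℝ^d`: `e_d(n, x) = ∑_{i₁+⋯+i_d = n} h_{i₁}(x₁)² ⋯ h_{i_d}(x_d)²`. -/
noncomputable def eSpec (d n : ℕ) (x : Fin d → ℝ) : ℝ :=
  ∑ i ∈ Finset.Nat.antidiagonalTuple d n, ∏ k, (hermiteFun (i k) (x k)) ^ 2

/-- `D(d, n) = binom(n+d−1, d−1)`, the dimension of the `n`-th eigenspace. -/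
def Ddim (d n : ℕ) : ℕ := Nat.choose (n + d - 1) (d - 1)

/-- The probabilistic Lebesgue norm `‖√(∑_n c_n² e_d(n,·)/D(d,n))‖_{L^p(ℝ^d)}`,
computed in `[0, ∞]`. -/
noncomputable def hermitePLnorm (d : ℕ) (p : ℝ) (c : ℕ → ℝ) : ℝ≥0∞ :=
  (∫⁻ x : Fin d → ℝ,
      (∑' n : ℕ, ENNReal.ofReal ((c n) ^ 2 * eSpec d n x / (Ddim d n))) ^ (p / 2)
    ∂volume) ^ (1 / p)


noncomputable def Hp : ℕ → Polynomial ℝ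
  | 0 => 1
  | n + 1 => 2 * Polynomial.X * Hp n - Polynomial.derivative (Hp n)

lemma Hp_der (n : ℕ) : Polynomial.derivative (Hp (n + 1)) = 2 * ((n : Polynomial ℝ) + 1) * Hp n := by
  induction n with
  | zero => simp [Hp]
  | succ n ih =>
    have e : Hp (n + 2) = 2 * Polynomial.X * Hp (n + 1) - Polynomial.derivative (Hp (n + 1)) := rfl
    have e1 : Hp (n + 1) = 2 * Polynomial.X * Hp n - Polynomial.derivative (Hp n) := rfl
    rw [e, ih]
    simp only [map_sub, Polynomial.derivative_mul, Polynomial.derivative_X, ih]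
    simp
    linear_combination (2 * ((n : Polynomial ℝ) + 1)) * (-e1)

lemma Hp_rec (n : ℕ) (x : ℝ) : (Hp (n + 2)).eval x =
    2 * x * (Hp (n + 1)).eval x - 2 * (n + 1) * (Hp n).eval x := by
  have e : Hp (n + 2) = 2 * Polynomial.X * Hp (n + 1) - Polynomial.derivative (Hp (n + 1)) := rfl
  rw [e, Hp_der]; simp

lemma iter_gauss (n : ℕ) : iteratedDeriv n (fun t : ℝ => Real.exp (-t ^ 2)) =
    fun x => (-1) ^ n * (Hp n).eval x * Real.exp (-x ^ 2) := by
  induction n with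
  | zero => ext x; simp [Hp]
  | succ n ih =>
    ext x
    rw [iteratedDeriv_succ, ih]
    have h1 := (Hp n).hasDerivAt x
    have h2 : HasDerivAt (fun x : ℝ => Real.exp (-x ^ 2)) (Real.exp (-x ^ 2) * (-(2 * x))) x := by
      have := ((hasDerivAt_pow 2 x).neg).exp
      simpa using this
    refine ((h1.const_mul ((-1) ^ n)).mul h2).deriv.trans ?_
    simp [Hp]; ring

lemma hermitePoly_eq (n : ℕ) (x : ℝ) : hermitePoly n x = (Hp n).eval x := by
  unfold hermitePoly
  rw [iter_gauss]
  have : Real.exp (x ^ 2) * Real.exp (-x ^ 2) = 1 := by rw [← Real.exp_add]; simp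
  have h2 : ((-1 : ℝ) ^ n) * (-1) ^ n = 1 := by rw [← mul_pow]; simp
  linear_combination ((-1 : ℝ) ^ n * (-1) ^ n * (Hp n).eval x) * this + (Hp n).eval x * h2

noncomputable def Nn (n : ℕ) : ℝ := (n.factorial : ℝ) * 2 ^ n * Real.sqrt Real.pi

lemma Nn_pos (n : ℕ) : 0 < Nn n := by unfold Nn; positivity

lemma Nn_succ (n : ℕ) : Nn (n + 1) = 2 * (n + 1) * Nn n := by
  unfold Nn; rw [Nat.factorial_succ]; push_cast; ring

lemma hsq (n : ℕ) (x : ℝ) : hermiteFun n x ^ 2 = (Hp n).eval x ^ 2 * Real.exp (-x ^ 2) / Nn n := by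
  unfold hermiteFun
  rw [hermitePoly_eq, ← Nn, div_pow, Real.sq_sqrt (Nn_pos n).le, mul_pow, ← Real.exp_nat_mul]
  congr 3; push_cast; ring

lemma m_one (x : ℝ) : hermiteFun 1 x ^ 2 = 2 * x ^ 2 * hermiteFun 0 x ^ 2 := by
  rw [hsq, hsq, Nn_succ]
  have := Nn_pos 0
  have e : (Hp 1).eval x = 2 * x := by simp [Hp]
  rw [e]; simp [Hp]; field_simp

lemma m_two (x : ℝ) : 2 * hermiteFun 2 x ^ 2 + (1 - 2 * x ^ 2) * (hermiteFun 1 x ^ 2 -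
   hermiteFun 0 x ^ 2) = 0 := by
  rw [hsq, hsq, hsq, Nn_succ, Nn_succ, Hp_rec]
  have := Nn_pos 0
  have e : (Hp 1).eval x = 2 * x := by simp [Hp]
  have e' : (Hp 0).eval x = 1 := by simp [Hp]
  rw [e, e']; push_cast; field_simp; ring

lemma m_rec (n : ℕ) (x : ℝ) : (n + 3) * hermiteFun (n + 3) x ^ 2 + (n + 2 - 2 * x ^ 2) *
    (hermiteFun (n + 2) x ^ 2 - hermiteFun (n + 1) x ^ 2) - (n + 1) * hermiteFun n x ^ 2 = 0 := by
  rw [hsq, hsq, hsq, hsq, Nn_succ, Nn_succ, Nn_succ, Hp_rec]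
  have := Nn_pos n
  have e := Hp_rec n x
  have h0 : (Hp n).eval x = (2 * x * (Hp (n + 1)).eval x - (Hp (n + 2)).eval x) / (2 * (n + 1)) := by
    field_simp; linear_combination e
  rw [h0]; push_cast; field_simp; ring

lemma integrable_poly (p : Polynomial ℝ) : Integrable (fun x : ℝ => p.eval x * Real.exp (-x ^ 2)) := by
  induction p using Polynomial.induction_on' with
  | add p q hp hq =>
    simp only [Polynomial.eval_add, add_mul]; exact hp.add hq
  | monomial n a =>
    have h := integrable_rpow_mul_exp_neg_mul_sq (b := 1) one_pos (s := n)
      (by have : (0 : ℝ) ≤ n := Nat.cast_nonneg n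
          linarith)
    have := h.const_mul a
    refine this.congr (Filter.Eventually.of_forall fun x => ?_)
    simp; ring

lemma int_Hp (n : ℕ) : ∫ x : ℝ, (Hp n).eval x ^ 2 * Real.exp (-x ^ 2) = Nn n := by
  induction n with
  | zero =>
    have := integral_gaussian 1
    simpa [Hp, Nn] using this
  | succ n ih =>
    have hv : ∀ x : ℝ, HasDerivAt (fun x : ℝ => -((Hp n).eval x * Real.exp (-x ^ 2)))
        ((Hp (n + 1)).eval x * Real.exp (-x ^ 2)) x := by
      intro x
      have h1 := (Hp n).hasDerivAt x
      have h2 : HasDerivAt (fun x : ℝ => Real.exp (-x ^ 2)) (Real.exp (-x ^ 2) * (-(2 * x))) x := by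
        have := ((hasDerivAt_pow 2 x).neg).exp
        simpa using this
      refine ((h1.mul h2).neg).congr_deriv ?_
      simp [Hp]; ring
    have hu : ∀ x : ℝ, HasDerivAt (fun x : ℝ => (Hp (n + 1)).eval x)
       ((2 * ((n : Polynomial ℝ) + 1) * Hp n).eval x) x := by
      intro x
      have := (Hp (n + 1)).hasDerivAt x
      rwa [Hp_der] at this
    have key := integral_mul_deriv_eq_deriv_mul_of_integrable (fun x _ => hu x) (fun x _ => hv x)
      ((integrable_poly (Hp (n + 1) * Hp (n + 1))).congr
        (Filter.Eventually.of_forall fun x => by simp; ring))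
      ((integrable_poly (-(2 * ((n : Polynomial ℝ) + 1) * Hp n) * Hp n)).congr
        (Filter.Eventually.of_forall fun x => by simp; ring))
      ((integrable_poly (-Hp (n + 1) * Hp n)).congr
        (Filter.Eventually.of_forall fun x => by simp; ring))
    calc ∫ x : ℝ, (Hp (n + 1)).eval x ^ 2 * Real.exp (-x ^ 2)
        = ∫ x : ℝ, (Hp (n + 1)).eval x * ((Hp (n + 1)).eval x * Real.exp (-x ^ 2)) := by
          congr 1; ext x; ring
      _ = 2 * (n + 1) * ∫ x : ℝ, (Hp n).eval x ^ 2 * Real.exp (-x ^ 2) := by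
          rw [key, ← integral_neg, ← integral_const_mul]
          congr 1; ext x; simp; ring
      _ = _ := by rw [ih, Nn_succ]

lemma int_hsq (n : ℕ) : ∫ x : ℝ, hermiteFun n x ^ 2 = 1 := by
  simp_rw [hsq]
  rw [integral_div, int_Hp, div_self (Nn_pos n).ne']

lemma integrable_hsq (n : ℕ) : Integrable (fun x : ℝ => hermiteFun n x ^ 2) := by
  simp_rw [hsq]
  refine Integrable.div_const ?_ _
  refine (integrable_poly (Hp n ^ 2)).congr (Filter.Eventually.of_forall fun x => by simp)

lemma cont_hsq (n : ℕ) : Continuous (fun x : ℝ => hermiteFun n x ^ 2) := by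
  simp_rw [hsq]
  fun_prop

lemma cont_eSpec (d n : ℕ) : Continuous (eSpec d n) := by
  unfold eSpec
  refine continuous_finsetSum _ fun i _ => continuous_finsetProd _ fun k _ => ?_
  exact (cont_hsq (i k)).comp (continuous_apply k)

lemma eSpec_nonneg (d n : ℕ) (x) : 0 ≤ eSpec d n x := by
  unfold eSpec
  positivity

lemma sum_tuple (d n : ℕ) (g : (Fin d → ℕ) → ℝ) :
    ∑ l ∈ Finset.finsuppAntidiag (Finset.univ : Finset (Fin d)) n, g l =
      ∑ i ∈ Finset.Nat.antidiagonalTuple d n, g i := by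
  refine Finset.sum_bij' (fun l _ => ⇑l) (fun i _ => Finsupp.equivFunOnFinite.symm i) ?_ ?_ ?_ ?_ ?_
  · intro l hl
    simpa [Finset.Nat.mem_antidiagonalTuple] using hl
  · intro l hl
    simpa [Finset.Nat.mem_antidiagonalTuple] using hl
  · intro l hl; simp
  · intro l hl; simp
  · intro l hl; rfl

lemma card_tuple (d n : ℕ) (hd : 2 ≤ d) : (Finset.Nat.antidiagonalTuple d n).card = Ddim d n := by
  have h := Finset.card_finsuppAntidiag_nat_eq_choose (s := (Finset.univ : Finset (Fin d))) n
  have h2 := sum_tuple d n (fun _ => 1)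
  simp at h2
  rw [← (by exact_mod_cast h2 : (Finset.finsuppAntidiag (Finset.univ : Finset (Fin d)) n).card =
    (Finset.Nat.antidiagonalTuple d n).card), h, Ddim]
  simp only [Finset.card_univ, Fintype.card_fin]
  rw [add_comm d n, ← Nat.choose_symm_of_eq_add]
  omega

lemma int_eSpec (d n : ℕ) (hd : 2 ≤ d) : Integrable (eSpec d n) ∧ ∫ x, eSpec d n x = Ddim d n := by
  have hi : ∀ i : Fin d → ℕ, Integrable (fun x : Fin d → ℝ => ∏ k, hermiteFun (i k) (x k) ^ 2) := by
    intro i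
    exact Integrable.fintype_prod (f := fun k x => hermiteFun (i k) x ^ 2) (fun k => integrable_hsq (i k))
  constructor
  · unfold eSpec
    exact integrable_finsetSum _ fun i _ => hi i
  · unfold eSpec
    rw [integral_finsetSum _ fun i _ => hi i]
    have : ∀ i : Fin d → ℕ, ∫ x : Fin d → ℝ, ∏ k, hermiteFun (i k) (x k) ^ 2 = 1 := by
      intro i
      rw [integral_fintype_prod_volume_eq_prod (fun k x => hermiteFun (i k) x ^ 2)]
      simp [int_hsq]
    simp [this, card_tuple d n hd]


noncomputable def qps : PowerSeries ℝ :=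
  1 + PowerSeries.X - PowerSeries.X ^ 2 - PowerSeries.X ^ 3
noncomputable def cps (δ c : ℝ) : PowerSeries ℝ :=
  PowerSeries.C δ * (PowerSeries.X + PowerSeries.X ^ 2) + PowerSeries.C c * (1 - PowerSeries.X)

lemma cps_add (δ c δ' c' : ℝ) : cps δ c + cps δ' c' = cps (δ + δ') (c + c') := by
  simp only [cps, map_add]; ring

lemma ps_ode (m : ℕ → ℝ) (δ c : ℝ) (h1 : m 1 = c * m 0)
    (h2 : 2 * m 2 + m 1 = δ * m 0 + c * (m 1 - m 0))
    (h3 : ∀ n : ℕ, (n + 3) * m (n + 3) + (n + 2) * m (n + 2) - (n + 1) * m (n + 1) - n * m n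
      = δ * (m (n + 1) + m n) + c * (m (n + 2) - m (n + 1))) :
    qps * PowerSeries.derivative ℝ (PowerSeries.mk m) = cps δ c * PowerSeries.mk m := by
  have e1 : qps * PowerSeries.derivative ℝ (PowerSeries.mk m) =
    PowerSeries.derivative ℝ (PowerSeries.mk m) +
    PowerSeries.X * PowerSeries.derivative ℝ (PowerSeries.mk m)
    - PowerSeries.X ^ 2 * PowerSeries.derivative ℝ (PowerSeries.mk m)
    - PowerSeries.X ^ 3 * PowerSeries.derivative ℝ (PowerSeries.mk m) := by
    unfold qps; ring
  have e2 : cps δ c * PowerSeries.mk m = PowerSeries.C δ * (PowerSeries.X * PowerSeries.mk m +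
    PowerSeries.X ^ 2 * PowerSeries.mk m) + PowerSeries.C c * (PowerSeries.mk m -
      PowerSeries.X * PowerSeries.mk m) := by
    unfold cps; ring
  rw [e1, e2]
  ext n
  match n with
  | 0 =>
    have e : PowerSeries.constantCoeff (PowerSeries.derivative ℝ (PowerSeries.mk m)) = m 1 := by
      rw [← PowerSeries.coeff_zero_eq_constantCoeff_apply, PowerSeries.coeff_derivative]; simp
    simp [e, h1]
  | 1 =>
    simp [PowerSeries.coeff_derivative, PowerSeries.coeff_X_pow_mul', PowerSeries.coeff_succ_X_mul]
    have e : PowerSeries.coeff 1 (PowerSeries.X * PowerSeries.derivative ℝ (PowerSeries.mk m)) = m 1 := by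
      rw [show (1 : ℕ) = 0 + 1 from rfl, PowerSeries.coeff_succ_X_mul]
      simp [PowerSeries.coeff_derivative]
    have e' : PowerSeries.coeff 1 (PowerSeries.X * (PowerSeries.mk m)) = m 0 := by
      rw [show (1 : ℕ) = 0 + 1 from rfl, PowerSeries.coeff_succ_X_mul]
      simp
    try rw [e]
    try rw [e']
    linarith
  | n + 2 =>
    have := h3 n
    rcases n with _ | n
    · simp [PowerSeries.coeff_derivative, PowerSeries.coeff_X_pow_mul', PowerSeries.coeff_succ_X_mul] at this ⊢
      linarith
    · simp [PowerSeries.coeff_derivative, PowerSeries.coeff_X_pow_mul', PowerSeries.coeff_succ_X_mul] at this ⊢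
      linarith

lemma ps_unique (F G q c : PowerSeries ℝ) (hq : q ≠ 0) (hF : q * PowerSeries.derivative ℝ F = c * F)
    (hG : q * PowerSeries.derivative ℝ G = c * G)
    (h0 : PowerSeries.constantCoeff F = PowerSeries.constantCoeff G)
    (hne : PowerSeries.constantCoeff G ≠ 0) : F = G := by
  have hW : PowerSeries.derivative ℝ F * G = F * PowerSeries.derivative ℝ G := by
    apply mul_left_cancel₀ hq
    linear_combination G * hF - F * hG
  have hGG : G * G⁻¹ = 1 := PowerSeries.mul_inv_cancel G hne
  have hD : PowerSeries.derivative ℝ (F * G⁻¹) = PowerSeries.derivative ℝ 1 := by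
    rw [Derivation.leibniz, PowerSeries.derivative_inv']
    simp only [smul_eq_mul, PowerSeries.derivative_one]
    linear_combination (G⁻¹ ^ 2) * hW - (G⁻¹ * PowerSeries.derivative ℝ F) * hGG
  have : F * G⁻¹ = 1 := by
    apply PowerSeries.derivative.ext hD
    simp [h0, hne]
  calc F = F * (G * G⁻¹) := by rw [hGG, mul_one]
    _ = (F * G⁻¹) * G := by ring
    _ = G := by rw [this, one_mul]

noncomputable def Mps (x : ℝ) : PowerSeries ℝ := PowerSeries.mk (fun n => hermiteFun n x ^ 2)

lemma Mps_ode (x : ℝ) : qps * PowerSeries.derivative ℝ (Mps x) = cps 1 (2 * x ^ 2) * Mps x := by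
  apply ps_ode
  · exact m_one x
  · linarith [m_two x]
  · intro n; linarith [m_rec n x]

lemma prod_ode {ι : Type*} (s : Finset ι) (f : ι → PowerSeries ℝ) (δ c : ι → ℝ)
    (h : ∀ i, qps * PowerSeries.derivative ℝ (f i) = cps (δ i) (c i) * f i) :
    qps * PowerSeries.derivative ℝ (∏ i ∈ s, f i) = cps (∑ i ∈ s, δ i) (∑ i ∈ s, c i) * ∏ i ∈ s, f i := by
  classical
  induction s using Finset.induction_on with
  | empty => simp [cps]
  | insert a s ha ih =>
    rw [Finset.prod_insert ha, Finset.sum_insert ha, Finset.sum_insert ha, ← cps_add, Derivation.leibniz]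
    simp only [smul_eq_mul]
    linear_combination (∏ i ∈ s, f i) * h a + f a * ih

lemma eSpec_coeff (d n : ℕ) (x : Fin d → ℝ) :
    eSpec d n x = PowerSeries.coeff n (∏ k, Mps (x k)) := by
  rw [PowerSeries.coeff_prod]
  simp only [Mps, PowerSeries.coeff_mk]
  rw [sum_tuple d n (fun i => ∏ k, hermiteFun (i k) (x k) ^ 2)]
  rfl

lemma qps_ne : qps ≠ 0 := by
  intro h
  have := congrArg PowerSeries.constantCoeff h
  simp [qps] at this

lemma M0 (x : ℝ) : PowerSeries.constantCoeff (Mps x) = Real.exp (-x ^ 2) / √Real.pi := by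
  rw [← PowerSeries.coeff_zero_eq_constantCoeff_apply]
  simp [Mps, hsq, Hp, Nn]

lemma m_zero_bound (n : ℕ) : (n + 1) * (hermiteFun n 0 ^ 2) ^ 2 ≤ 1 := by
  have hpi : (1 : ℝ) ≤ √Real.pi := by
    rw [Real.one_le_sqrt]; linarith [Real.pi_gt_three]
  have m0 : hermiteFun 0 0 ^ 2 ≤ 1 := by
    simp [hsq, Hp, Nn]; exact inv_le_one_of_one_le₀ hpi
  have m1 : hermiteFun 1 0 ^ 2 = 0 := by rw [m_one]; simp
  have key : ∀ n : ℕ, (n + 2) * hermiteFun (n + 2) 0 ^ 2 = (n + 1) * hermiteFun n 0 ^ 2 := by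
    intro n
    induction n using Nat.strong_induction_on with
    | _ n ih =>
    rcases n with _ | n
    · have := m_two 0; norm_num at this ⊢; rw [m1] at this; linarith
    · have := m_rec n 0
      have h2 := ih n (by omega)
      push_cast at *
      norm_num at this ⊢
      have e : (n : ℝ) + 1 + 2 = n + 3 := by ring
      rw [e]
      linarith
  induction n using Nat.strong_induction_on with
  | _ n ih =>
  match n with
  | 0 => 
    have : 0 ≤ hermiteFun 0 0 ^ 2 := by positivity
    rw [Nat.cast_zero, zero_add, one_mul]; nlinarith
  | 1 => simp [m1]
  | n + 2 =>
    have h := ih n (by omega)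
    have k := key n
    have e : hermiteFun (n + 2) 0 ^ 2 = (n + 1) * hermiteFun n 0 ^ 2 / (n + 2) := by
      field_simp; linarith
    rw [e]
    push_cast
    refine le_trans ?_ h
    have : ((n : ℝ) + 2 + 1) * ((n + 1) * hermiteFun n 0 ^ 2 / (n + 2)) ^ 2 =
      (n + 1) * (hermiteFun n 0 ^ 2) ^ 2 * ((n + 3) * (n + 1) / (n + 2) ^ 2) := by field_simp; ring
    rw [this]
    apply mul_le_of_le_one_right (by positivity)
    rw [div_le_one (by positivity)]
    nlinarith

lemma m_zero_sum (n : ℕ) : ∑ j ∈ Finset.range (n + 1), hermiteFun j 0 ^ 2 ≤ 2 * √(n + 1) := by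
  have hb : ∀ n : ℕ, hermiteFun n 0 ^ 2 ≤ 1 / √(n + 1) := by
    intro n
    rw [le_div_iff₀ (by positivity)]
    have h := m_zero_bound n
    have h2 := Real.sq_sqrt (show (0 : ℝ) ≤ n + 1 by positivity)
    by_contra! hc
    nlinarith [Real.sqrt_nonneg ((n : ℝ) + 1)]
  induction n with
  | zero => have := hb 0; simp only [Nat.cast_zero, zero_add, Real.sqrt_one] at this ⊢; rw [Finset.sum_range_one]; linarith
  | succ n ih =>
    rw [Finset.sum_range_succ]
    have h := hb (n + 1)
    push_cast at h ⊢
    have a := Real.sq_sqrt (show (0 : ℝ) ≤ n + 1 by positivity)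
    have b := Real.sq_sqrt (show (0 : ℝ) ≤ n + 1 + 1 by positivity)
    have pa : 0 < √((n : ℝ) + 1) := by positivity
    have pb : 0 < √((n : ℝ) + 1 + 1) := by positivity
    set A := √((n : ℝ) + 1)
    set B := √((n : ℝ) + 1 + 1)
    have hAB : A ≤ B := by nlinarith
    have : 1 / B ≤ 2 * (B - A) := by
      rw [div_le_iff₀ pb]; nlinarith
    linarith

lemma pow_sum (m n : ℕ) : (∀ j, 0 ≤ PowerSeries.coeff j (Mps 0 ^ m)) ∧
   ∑ j ∈ Finset.range (n + 1), PowerSeries.coeff j (Mps 0 ^ m) ≤ (2 * √(n + 1)) ^ m := by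
  induction m with
  | zero =>
    constructor
    · intro j; simp [PowerSeries.coeff_one]; split_ifs <;> norm_num
    · simp [PowerSeries.coeff_one]
  | succ m ih =>
    obtain ⟨h1, h2⟩ := ih
    have hM : ∀ j, 0 ≤ PowerSeries.coeff j (Mps 0) := by
      intro j; simp only [Mps, PowerSeries.coeff_mk]; positivity
    constructor
    · intro j
      rw [pow_succ, PowerSeries.coeff_mul]
      exact Finset.sum_nonneg fun p _ => mul_nonneg (h1 _) (hM _)
    · have hs : ∑ j ∈ Finset.range (n + 1), PowerSeries.coeff j (Mps 0) ≤ 2 * √(n + 1) := by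
        simpa [Mps] using m_zero_sum n
      rw [pow_succ]
      have hpos : (0 : ℝ) ≤ (2 * √(n + 1)) ^ m := by positivity
      refine le_trans ?_ (mul_le_mul h2 hs (Finset.sum_nonneg fun j _ => hM j) hpos)
      rw [Finset.sum_mul_sum, ← Finset.sum_product']
      simp_rw [PowerSeries.coeff_mul]
      rw [← Finset.sum_biUnion]
      · apply Finset.sum_le_sum_of_subset_of_nonneg
        · intro p hp
          simp only [Finset.mem_biUnion, Finset.mem_range, Finset.HasAntidiagonal.mem_antidiagonal,
            Finset.mem_product] at hp ⊢
          obtain ⟨a, ha, hb⟩ := hp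
          omega
        · intro p _ _
          exact mul_nonneg (h1 _) (hM _)
      · intro a _ b _ hab
        rw [Function.onFun, Finset.disjoint_left]
        intro p hp hq
        rw [Finset.HasAntidiagonal.mem_antidiagonal] at hp hq
        exact hab (hp.symm.trans hq)


lemma ptwise_K (A B k z v : ℝ) (hA : 0 < A) (hB : 0 < B) (hk : 0 < k)
    (h2 : k ^ 2 ≤ 2 * A * B ^ 3) :
    |k ^ 2 * A / (2 * B ^ 3) * z * v| ≤ 1 / 2 * (A / B * v ^ 2 + A ^ 3 * B * z ^ 2) ∧
    A ^ 2 * |z * v| ≤ 1 / 2 * (A / B * v ^ 2 + A ^ 3 * B * z ^ 2) := by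
  have h1 : A ^ 2 * |z * v| ≤ 1 / 2 * (A / B * v ^ 2 + A ^ 3 * B * z ^ 2) := by
    have e : 1 / 2 * (A / B * v ^ 2 + A ^ 3 * B * z ^ 2) - A ^ 2 * |z * v| =
       A / (2 * B) * (|v| - A * B * |z|) ^ 2 := by
      rw [abs_mul]
      rw [← sq_abs v, ← sq_abs z]
      field_simp; ring
    have : 0 ≤ A / (2 * B) * (|v| - A * B * |z|) ^ 2 := by positivity
    linarith
  refine ⟨?_, h1⟩
  refine le_trans ?_ h1
  rw [mul_assoc, abs_mul, abs_of_pos (by positivity)]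
  apply mul_le_mul_of_nonneg_right _ (abs_nonneg _)
  rw [div_le_iff₀ (by positivity)]
  nlinarith

lemma ptwise_psi (A B k : ℝ) (hA : 0 < A) (hB : 0 < B) (hk : 0 < k)
    (h : A ^ 2 + 4 * B ^ 2 = 4 * k ^ 2) :
    k ^ 2 / 4 * (1 / (A ^ 3 * B ^ 3) + 3 / (4 * A * B ^ 5)) ≤ 3 / (k * A ^ 3) + 3 * k / (8 * B ^ 5) := by
  have key : 4 * k ^ 3 * B ^ 2 + 3 * k ^ 3 * A ^ 2 ≤ 48 * B ^ 5 + 6 * k ^ 2 * A ^ 3 := by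
    have eA : A ^ 2 = 4 * k ^ 2 - 4 * B ^ 2 := by linarith
    rw [eA]
    by_cases hc : k ^ 2 ≤ 2 * B ^ 2
    · have hb : 0.7 * k ≤ B := by nlinarith
      have h5 : (0.7 * k) ^ 5 ≤ B ^ 5 := pow_le_pow_left₀ (by positivity) hb 5
      have h3 : 0 ≤ k ^ 3 * (2 * B ^ 2 - k ^ 2) := mul_nonneg (by positivity) (by linarith)
      have h6 : 0 ≤ 6 * k ^ 2 * A ^ 3 := by positivity
      nlinarith [pow_pos hk 5]
    · have ha : 1.4 * k ≤ A := by nlinarith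
      have h5 : (1.4 * k) ^ 3 ≤ A ^ 3 := pow_le_pow_left₀ (by positivity) ha 3
      have h7 : k ^ 2 * (1.4 * k) ^ 3 ≤ k ^ 2 * A ^ 3 := by gcongr
      have h6 : 0 ≤ 48 * B ^ 5 := by positivity
      have h8 : 0 ≤ k ^ 3 * B ^ 2 := by positivity
      nlinarith [pow_pos hk 5]
  have e : 3 / (k * A ^ 3) + 3 * k / (8 * B ^ 5) -
      k ^ 2 / 4 * (1 / (A ^ 3 * B ^ 3) + 3 / (4 * A * B ^ 5)) =
      (48 * B ^ 5 + 6 * k ^ 2 * A ^ 3 - (4 * k ^ 3 * B ^ 2 + 3 * k ^ 3 * A ^ 2)) / (16 * k * A ^ 3 * B ^ 5) := by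
    field_simp; ring
  have : 0 ≤ (48 * B ^ 5 + 6 * k ^ 2 * A ^ 3 - (4 * k ^ 3 * B ^ 2 + 3 * k ^ 3 * A ^ 2)) / (16 * k * A ^ 3 * B ^ 5) :=
    div_nonneg (by linarith) (by positivity)
  linarith

lemma ptwise_deriv (A B k z v : ℝ) (hA : 0 < A) (hB : 0 < B) (hk : 0 < k)
    (h : A ^ 2 + 4 * B ^ 2 = 4 * k ^ 2) (h2 : k ^ 2 ≤ 2 * A * B ^ 3) :
    k ^ 2 / 4 * (1 / (A * B ^ 3) - 3 * A / (4 * B ^ 5)) * z * v ≤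
     (3 / (k * A ^ 3) + 3 * k / (8 * B ^ 5)) *
      (A / B * v ^ 2 + A ^ 3 * B * z ^ 2 - k ^ 2 * A / (2 * B ^ 3) * z * v) := by
  obtain ⟨p1, p2⟩ := ptwise_K A B k z v hA hB hk h2
  have p3 := ptwise_psi A B k hA hB hk h
  have p4 := le_abs_self (k ^ 2 * A / (2 * B ^ 3) * z * v)
  have e1 : k ^ 2 / 4 * (1 / (A * B ^ 3) - 3 * A / (4 * B ^ 5)) * z * v ≤
      (k ^ 2 / 4 * (1 / (A ^ 3 * B ^ 3) + 3 / (4 * A * B ^ 5))) * (A ^ 2 * |z * v|) := by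
    have e : (k ^ 2 / 4 * (1 / (A ^ 3 * B ^ 3) + 3 / (4 * A * B ^ 5))) * (A ^ 2 * |z * v|) =
      k ^ 2 / 4 * (1 / (A * B ^ 3) + 3 * A / (4 * B ^ 5)) * |z * v| := by field_simp
    rw [e, mul_assoc _ z v]
    have q1 : 0 ≤ 1 / (A * B ^ 3) := by positivity
    have q2 : 0 ≤ 3 * A / (4 * B ^ 5) := by positivity
    have q3 := le_abs_self (z * v)
    have q4 := neg_abs_le (z * v)
    rw [mul_assoc, mul_assoc]
    apply mul_le_mul_of_nonneg_left _ (by positivity)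
    nlinarith
  refine e1.trans ?_
  have q5 : 0 ≤ A ^ 2 * |z * v| := by positivity
  have q6 : 0 ≤ 3 / (k * A ^ 3) + 3 * k / (8 * B ^ 5) := by positivity
  refine mul_le_mul p3 ?_ q5 q6
  linarith

/-- energy is decreasing -/
lemma energy_anti (κ : ℝ) (hκ : 0 < κ) (z zd v : ℝ → ℝ) (hz : ∀ t, HasDerivAt z (zd t) t)
    (hv : ∀ t, v t = z t + t * zd t) (hv' : ∀ t, HasDerivAt v ((t / 4 - κ) * z t) t) :
    Antitone (fun t => v t ^ 2 + (κ - t / 4) * t * z t ^ 2) := by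
  have hd : ∀ t, HasDerivAt (fun t => v t ^ 2 + (κ - t / 4) * t * z t ^ 2) (-κ * z t ^ 2) t := by
    intro t
    have h1 := (hv' t).pow 2
    have h2 : HasDerivAt (fun t : ℝ => (κ - t / 4) * t) ((0 - 1 / 4) * t + (κ - t / 4) * 1) t :=
      ((hasDerivAt_const t κ).sub ((hasDerivAt_id t).div_const 4)).mul (hasDerivAt_id t)
    have h3 := h2.mul ((hz t).pow 2)
    refine (h1.add h3).congr_deriv ?_
    simp only [Nat.cast_ofNat]
    rw [hv t]; simp; ring
  apply antitone_of_deriv_nonpos (fun t => (hd t).differentiableAt)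
  intro t
  rw [(hd t).deriv]
  nlinarith [sq_nonneg (z t)]

lemma hasDeriv_A (t : ℝ) (ht : 0 < t) : HasDerivAt (fun t => √t) (1 / (2 * √t)) t :=
  Real.hasDerivAt_sqrt ht.ne'

lemma hasDeriv_B (κ t : ℝ) (ht : 0 < κ - t / 4) :
    HasDerivAt (fun t => √(κ - t / 4)) (-1 / (8 * √(κ - t / 4))) t := by
  have h2 : HasDerivAt (fun t : ℝ => (κ - t / 4)) (0 - 1 / 4) t :=
      ((hasDerivAt_const t κ).sub ((hasDerivAt_id t).div_const 4))
  refine (h2.sqrt ht.ne').congr_deriv ?_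
  have : 0 < √(κ - t / 4) := Real.sqrt_pos.2 ht
  generalize √(κ - t / 4) = B at *
  field_simp; norm_num

lemma wkb (k t₀ t₁ : ℝ) (hk : 0 < k) (ht0 : 0 < t₀) (ht1 : t₁ < 4 * k ^ 2)
    (hφ : ∀ t ∈ Set.Icc t₀ t₁, k ^ 2 ≤ 2 * √t * √(k ^ 2 - t / 4) ^ 3)
    (z zd v : ℝ → ℝ) (hz : ∀ t, HasDerivAt z (zd t) t)
    (hv : ∀ t, v t = z t + t * zd t) (hv' : ∀ t, HasDerivAt v ((t / 4 - k ^ 2) * z t) t) :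
    AntitoneOn (fun t => (√t / √(k ^ 2 - t / 4) * v t ^ 2 + √t ^ 3 * √(k ^ 2 - t / 4) * z t ^ 2
      - k ^ 2 * √t / (2 * √(k ^ 2 - t / 4) ^ 3) * z t * v t) *
        Real.exp (6 / (k * √t) - k / √(k ^ 2 - t / 4) ^ 3)) (Set.Icc t₀ t₁) := by
  have hd : ∀ t ∈ Set.Icc t₀ t₁, ∃ D, HasDerivAt (fun t => (√t / √(k ^ 2 - t / 4) * v t ^ 2 +
        √t ^ 3 * √(k ^ 2 - t / 4) * z t ^ 2
      - k ^ 2 * √t / (2 * √(k ^ 2 - t / 4) ^ 3) * z t * v t) *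
        Real.exp (6 / (k * √t) - k / √(k ^ 2 - t / 4) ^ 3)) D t ∧ D ≤ 0 := by
    intro t ht
    have t0 : 0 < t := lt_of_lt_of_le ht0 ht.1
    have f0 : 0 < k ^ 2 - t / 4 := by linarith [ht.2]
    have hA := hasDeriv_A t t0
    have hB := hasDeriv_B (k ^ 2) t f0
    have Ap : 0 < √t := Real.sqrt_pos.2 t0
    have Bp : 0 < √(k ^ 2 - t / 4) := Real.sqrt_pos.2 f0
    have A2 : √t ^ 2 = t := Real.sq_sqrt t0.le
    have B2 : √(k ^ 2 - t / 4) ^ 2 = k ^ 2 - t / 4 := Real.sq_sqrt f0.le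
    have hv1 := hv t
    have hv2 := hv' t
    have hz1 := hz t
    have hf := hφ t ht
    have d1 := (hA.div hB Bp.ne').mul (hv2.pow 2)
    have d2 := ((hA.pow 3).mul hB).mul (hz1.pow 2)
    have d3 := (((hA.const_mul (k ^ 2)).div ((hB.pow 3).const_mul 2) (by simp; positivity)).mul hz1).mul hv2
    have d4 := (((hasDerivAt_const t (6 : ℝ)).div (hA.const_mul k) (by positivity)).sub
      ((hasDerivAt_const t k).div (hB.pow 3) (by simp; positivity))).exp
    have hrel : √t ^ 2 + 4 * √(k ^ 2 - t / 4) ^ 2 = 4 * k ^ 2 := by rw [A2, B2]; ring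
    have pw := ptwise_deriv (√t) (√(k ^ 2 - t / 4)) k (z t) (v t) Ap Bp hk hrel hf
    have hzd : zd t = (v t - z t) / √t ^ 2 := by rw [A2]; field_simp; linarith
    have hft : t / 4 - k ^ 2 = - √(k ^ 2 - t / 4) ^ 2 := by rw [B2]; ring
    have dK := ((d1.add d2).sub d3).congr_deriv (f' := _)
      (g' := k ^ 2 / 4 * (1 / (√t * √(k ^ 2 - t / 4) ^ 3) - 3 * √t / (4 * √(k ^ 2 - t / 4) ^ 5)) *
        z t * v t) (by
        simp only [Pi.mul_apply, Pi.add_apply, Pi.sub_apply, Pi.div_apply, Pi.pow_apply]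
        rw [hzd, hft]
        clear d1 d2 d3 d4 pw hA hB hf
        generalize √t = A at *
        generalize √(k ^ 2 - t / 4) = B at *
        generalize z t = Z at *
        generalize v t = V at *
        have hk2 : k ^ 2 = A ^ 2 / 4 + B ^ 2 := by linarith
        rw [hk2]
        field_simp
        push_cast
        ring)
    have d5 := d4.congr_deriv (f' := _) (g' := Real.exp (6 / (k * √t) - k / √(k ^ 2 - t / 4) ^ 3) *
       -(3 / (k * √t ^ 3) + 3 * k / (8 * √(k ^ 2 - t / 4) ^ 5))) (by
        simp only [Pi.mul_apply, Pi.add_apply, Pi.sub_apply, Pi.div_apply, Pi.pow_apply]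
        congr 1
        clear d1 d2 d3 d4 pw hA hB hf dK
        generalize √t = A at *
        generalize √(k ^ 2 - t / 4) = B at *
        field_simp
        push_cast
        ring)
    refine ⟨_, dK.mul d5, ?_⟩
    have hexp := Real.exp_pos (6 / (k * √t) - k / √(k ^ 2 - t / 4) ^ 3)
    simp only [Pi.mul_apply, Pi.add_apply, Pi.sub_apply, Pi.div_apply, Pi.pow_apply]
    clear d1 d2 d3 d4 d5 dK hA hB hf
    generalize Real.exp (6 / (k * √t) - k / √(k ^ 2 - t / 4) ^ 3) = X at *
    have e : ∀ L R : ℝ, L ≤ R → (L - R) * X ≤ 0 := fun L R h => by nlinarith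
    refine le_of_eq_of_le ?_ (e _ _ pw)
    ring
  apply antitoneOn_of_deriv_nonpos (convex_Icc _ _)
  · intro t ht
    obtain ⟨D, h, _⟩ := hd t ht
    exact h.continuousAt.continuousWithinAt
  · intro t ht
    obtain ⟨D, h, _⟩ := hd t (interior_subset ht)
    exact h.differentiableAt.differentiableWithinAt
  · intro t ht
    obtain ⟨D, h, h'⟩ := hd t (interior_subset ht)
    rw [h.deriv]; exact h'


noncomputable def c1 : ℝ := √(6 * Real.exp 8)
lemma c1_sq : c1 ^ 2 = 6 * Real.exp 8 := Real.sq_sqrt (by positivity)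
lemma c1_pos : 0 < c1 := Real.sqrt_pos.2 (by positivity)

lemma phi_le (b k t : ℝ) (hb : 1 ≤ b) (hk : k = b ^ 3) (h1 : 2 / k ^ 2 ≤ t)
    (h2 : t ≤ 4 * k ^ 2 - 2 * b ^ 2) : k ^ 2 ≤ 2 * √t * √(k ^ 2 - t / 4) ^ 3 := by
  have hk1 : 1 ≤ k := by rw [hk]; exact one_le_pow₀ hb
  have ht0 : 0 < t := lt_of_lt_of_le (by positivity) h1
  have hf : b ^ 2 / 2 ≤ k ^ 2 - t / 4 := by linarith
  have hf0 : 0 ≤ k ^ 2 - t / 4 := le_trans (by positivity) hf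
  apply le_of_sq_le_sq _ (by positivity)
  have e : (2 * √t * √(k ^ 2 - t / 4) ^ 3) ^ 2 = 4 * t * (k ^ 2 - t / 4) ^ 3 := by
    have a := Real.sq_sqrt ht0.le
    have b := Real.sq_sqrt hf0
    calc _ = 4 * (√t ^ 2) * (√(k ^ 2 - t / 4) ^ 2) ^ 3 := by ring
      _ = _ := by rw [a, b]
  rw [e]
  by_cases hc : t ≤ 2 * k ^ 2
  · have h3 : (k ^ 2 / 2) ^ 3 ≤ (k ^ 2 - t / 4) ^ 3 :=
      pow_le_pow_left₀ (by positivity) (by linarith) 3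
    calc (k ^ 2) ^ 2 = 4 * (2 / k ^ 2) * (k ^ 2 / 2) ^ 3 := by field_simp; norm_num
      _ ≤ _ := by gcongr
  · have h3 : (b ^ 2 / 2) ^ 3 ≤ (k ^ 2 - t / 4) ^ 3 :=
      pow_le_pow_left₀ (by positivity) (by linarith) 3
    calc (k ^ 2) ^ 2 = 4 * (2 * k ^ 2) * (b ^ 2 / 2) ^ 3 := by rw [hk]; ring
      _ ≤ _ := by
        push Not at hc
        gcongr

set_option maxHeartbeats 1000000 in
lemma Jbound (b k : ℝ) (hb : 1 ≤ b) (hk : k = b ^ 3)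
    (z zd v : ℝ → ℝ) (hz : ∀ t, HasDerivAt z (zd t) t)
    (hv : ∀ t, v t = z t + t * zd t) (hv' : ∀ t, HasDerivAt v ((t / 4 - k ^ 2) * z t) t)
    (hv0 : v 0 ^ 2 = (k ^ 2) ^ 2) (t : ℝ) (h1 : 2 / k ^ 2 ≤ t)
    (h2 : t ≤ 4 * k ^ 2 - 2 * b ^ 2) :
    √t / √(k ^ 2 - t / 4) * v t ^ 2 + √t ^ 3 * √(k ^ 2 - t / 4) * z t ^ 2 ≤ c1 ^ 2 * k ^ 2 := by
  have hk1 : 1 ≤ k := by rw [hk]; exact one_le_pow₀ hb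
  have hk0 : 0 < k := by linarith
  have hbk : b ^ 2 ≤ k ^ 2 := by
    rw [hk, ← pow_mul]; exact pow_le_pow_right₀ hb (by norm_num)
  have hanti := wkb k (2 / k ^ 2) (4 * k ^ 2 - 2 * b ^ 2) hk0 (by positivity)
    (by nlinarith) (fun t ht => phi_le b k t hb hk ht.1 ht.2) z zd v hz hv hv'
  have hlow : 2 / k ^ 2 ≤ 2 * k ^ 2 := by
    rw [div_le_iff₀ (by positivity)]
    have : 1 ≤ k ^ 2 := one_le_pow₀ hk1
    nlinarith
  have hle : 2 / k ^ 2 ≤ 4 * k ^ 2 - 2 * b ^ 2 := by linarith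
  have hE := hanti ⟨le_refl _, hle⟩ ⟨h1, h2⟩ h1
  simp only at hE
  have ht0 : 0 < t := lt_of_lt_of_le (by positivity) h1
  have hs0 : 0 < 2 / k ^ 2 := by positivity
  set s := 2 / k ^ 2 with hs
  have f0 : 0 < k ^ 2 - t / 4 := by nlinarith
  have g0 : k ^ 2 / 2 ≤ k ^ 2 - s / 4 := by linarith
  have g00 : 0 < k ^ 2 - s / 4 := lt_of_lt_of_le (by positivity) g0
  have Ap : 0 < √t := Real.sqrt_pos.2 ht0
  have Bp : 0 < √(k ^ 2 - t / 4) := Real.sqrt_pos.2 f0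
  have Asp : 0 < √s := Real.sqrt_pos.2 hs0
  have Bsp : 0 < √(k ^ 2 - s / 4) := Real.sqrt_pos.2 g00
  have As2 : √s ^ 2 = s := Real.sq_sqrt hs0.le
  have Bs2 : √(k ^ 2 - s / 4) ^ 2 = k ^ 2 - s / 4 := Real.sq_sqrt g00.le
  have At2 : √t ^ 2 = t := Real.sq_sqrt ht0.le
  have Bt2 : √(k ^ 2 - t / 4) ^ 2 = k ^ 2 - t / 4 := Real.sq_sqrt f0.le
  obtain ⟨p1, -⟩ := ptwise_K (√t) (√(k ^ 2 - t / 4)) k (z t) (v t) Ap Bp hk0 (phi_le b k t hb hk h1 h2)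
  obtain ⟨p2, -⟩ := ptwise_K (√s) (√(k ^ 2 - s / 4)) k (z s) (v s) Asp Bsp hk0 (phi_le b k s hb hk le_rfl hle)
  have p1' := le_abs_self (k ^ 2 * √t / (2 * √(k ^ 2 - t / 4) ^ 3) * z t * v t)
  have p2' := neg_abs_le (k ^ 2 * √s / (2 * √(k ^ 2 - s / 4) ^ 3) * z s * v s)
  -- energy at s
  have hen := energy_anti (k ^ 2) (by positivity) z zd v hz hv hv' hs0.le
  simp only [hv0] at hen
  have hJs : √s / √(k ^ 2 - s / 4) * v s ^ 2 + √s ^ 3 * √(k ^ 2 - s / 4) * z s ^ 2 ≤ 2 * k ^ 2 := by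
    have e : √s / √(k ^ 2 - s / 4) * v s ^ 2 + √s ^ 3 * √(k ^ 2 - s / 4) * z s ^ 2 =
       √s / √(k ^ 2 - s / 4) * (v s ^ 2 + (k ^ 2 - s / 4) * s * z s ^ 2) := by
      have : (k ^ 2 - s / 4) * s = √(k ^ 2 - s / 4) ^ 2 * √s ^ 2 := by rw [As2, Bs2]
      rw [this]; field_simp
    rw [e]
    have r : √s / √(k ^ 2 - s / 4) ≤ 2 / k ^ 2 := by
      rw [div_le_iff₀ Bsp]
      apply le_of_sq_le_sq _ (by positivity)
      rw [mul_pow, As2, Bs2, hs]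
      rw [hs] at g0
      calc 2 / k ^ 2 = (2 / k ^ 2) ^ 2 * (k ^ 2 / 2) := by field_simp
        _ ≤ _ := by gcongr
    calc _ ≤ (2 / k ^ 2) * ((k ^ 2) ^ 2) := by
          apply mul_le_mul r _ _ (by positivity)
          · simpa using hen
          · have := g00.le; positivity
      _ = _ := by field_simp
  -- exponents
  have hx1 : 6 / (k * √s) ≤ 5 := by
    have : k * √s = √2 := by
      rw [hs, Real.sqrt_div (by norm_num), Real.sqrt_sq hk0.le]; field_simp
    rw [this, div_le_iff₀ (by positivity)]
    have := Real.sq_sqrt (show (0 : ℝ) ≤ 2 by norm_num)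
    nlinarith [Real.sqrt_nonneg 2]
  have hx2 : k / √(k ^ 2 - t / 4) ^ 3 ≤ 3 := by
    rw [div_le_iff₀ (by positivity)]
    apply le_of_sq_le_sq _ (by positivity)
    have : (3 * √(k ^ 2 - t / 4) ^ 3) ^ 2 = 9 * (k ^ 2 - t / 4) ^ 3 := by
      calc _ = 9 * (√(k ^ 2 - t / 4) ^ 2) ^ 3 := by ring
        _ = _ := by rw [Bt2]
    rw [this]
    have h3 : (b ^ 2 / 2) ^ 3 ≤ (k ^ 2 - t / 4) ^ 3 :=
      pow_le_pow_left₀ (by positivity) (by linarith) 3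
    have : k ^ 2 = 8 * (b ^ 2 / 2) ^ 3 := by rw [hk]; ring
    have h5 : 0 ≤ (b ^ 2 / 2) ^ 3 := by positivity
    linarith
  have hx3 : 0 ≤ 6 / (k * √t) := by positivity
  have hx4 : 0 ≤ k / √(k ^ 2 - s / 4) ^ 3 := by positivity
  set Et := 6 / (k * √t) - k / √(k ^ 2 - t / 4) ^ 3
  set Es := 6 / (k * √s) - k / √(k ^ 2 - s / 4) ^ 3
  have hEE : Real.exp Es ≤ Real.exp 8 * Real.exp Et := by
    rw [← Real.exp_add]; apply Real.exp_le_exp.2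
    simp only [Es, Et]; linarith
  have hEt := Real.exp_pos Et
  set Jt := √t / √(k ^ 2 - t / 4) * v t ^ 2 + √t ^ 3 * √(k ^ 2 - t / 4) * z t ^ 2
  set Js := √s / √(k ^ 2 - s / 4) * v s ^ 2 + √s ^ 3 * √(k ^ 2 - s / 4) * z s ^ 2
  set Qt := k ^ 2 * √t / (2 * √(k ^ 2 - t / 4) ^ 3) * z t * v t
  set Qs := k ^ 2 * √s / (2 * √(k ^ 2 - s / 4) ^ 3) * z s * v s
  have : Jt / 2 * Real.exp Et ≤ 3 * k ^ 2 * Real.exp 8 * Real.exp Et := by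
    calc Jt / 2 * Real.exp Et ≤ (Jt - Qt) * Real.exp Et := by gcongr; linarith
      _ ≤ (Js - Qs) * Real.exp Es := hE
      _ ≤ (3 * k ^ 2) * Real.exp Es := by gcongr; linarith
      _ ≤ (3 * k ^ 2) * (Real.exp 8 * Real.exp Et) := by gcongr
      _ = _ := by ring
  have := le_of_mul_le_mul_right this hEt
  rw [c1_sq]; linarith



lemma dom_mvt (f f' g g' : ℝ → ℝ) (a b : ℝ) (hab : a ≤ b)
    (hf : ∀ t ∈ Set.Icc a b, HasDerivAt f (f' t) t) (hg : ∀ t ∈ Set.Icc a b, HasDerivAt g (g' t) t)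
    (h : ∀ t ∈ Set.Icc a b, |f' t| ≤ g' t) : |f b - f a| ≤ g b - g a := by
  have main : ∀ (u u' : ℝ → ℝ), (∀ t ∈ Set.Icc a b, HasDerivAt u (u' t) t) →
      (∀ t ∈ Set.Icc a b, 0 ≤ u' t) → u a ≤ u b := by
    intro u u' hu hu'
    have : MonotoneOn u (Set.Icc a b) := by
      apply monotoneOn_of_deriv_nonneg (convex_Icc _ _)
      · intro t ht; exact (hu t ht).continuousAt.continuousWithinAt
      · intro t ht; exact (hu t (interior_subset ht)).differentiableAt.differentiableWithinAt
      · intro t ht; rw [(hu t (interior_subset ht)).deriv]; exact hu' t (interior_subset ht)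
    exact this ⟨le_refl _, hab⟩ ⟨hab, le_refl _⟩ hab
  have m1 := main _ _ (fun t ht => (hg t ht).sub (hf t ht)) (fun t ht => by
    have := (abs_le.1 (h t ht)).2; linarith)
  have m2 := main _ _ (fun t ht => (hg t ht).add (hf t ht)) (fun t ht => by
    have := (abs_le.1 (h t ht)).1; linarith)
  simp only [Pi.sub_apply, Pi.add_apply] at m1 m2
  rw [abs_le]; constructor <;> linarith

lemma hasDeriv_G (κ : ℝ) (z v S : ℝ → ℝ) (hv' : ∀ t, HasDerivAt v ((t / 4 - κ) * z t) t)
    (hS : ∀ t, HasDerivAt S (-z t / 2) t) (t : ℝ) (hf : 0 < κ - t / 4) :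
    HasDerivAt (fun t => S t - v t / (2 * (κ - t / 4))) (-v t / (8 * (κ - t / 4) ^ 2)) t := by
  have h2 : HasDerivAt (fun t : ℝ => 2 * (κ - t / 4)) (2 * (0 - 1 / 4)) t :=
      ((hasDerivAt_const t κ).sub ((hasDerivAt_id t).div_const 4)).const_mul 2
  refine ((hS t).sub ((hv' t).div h2 (by positivity))).congr_deriv ?_
  have e : t / 4 - κ = - (κ - t / 4) := by ring
  rw [e]
  generalize κ - t / 4 = F at *
  field_simp; ring

lemma v_le (b k : ℝ) (hb : 1 ≤ b) (hk : k = b ^ 3)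
    (z zd v : ℝ → ℝ) (hz : ∀ t, HasDerivAt z (zd t) t)
    (hv : ∀ t, v t = z t + t * zd t) (hv' : ∀ t, HasDerivAt v ((t / 4 - k ^ 2) * z t) t)
    (hv0 : v 0 ^ 2 = (k ^ 2) ^ 2) (t : ℝ) (h0 : 0 ≤ t) (h1 : t ≤ 4 * k ^ 2) : |v t| ≤ k ^ 2 := by
  have hk1 : 1 ≤ k := by rw [hk]; exact one_le_pow₀ hb
  have hen := energy_anti (k ^ 2) (by positivity) z zd v hz hv hv' h0
  simp only [hv0] at hen
  apply abs_le_of_sq_le_sq _ (by positivity)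
  have : 0 ≤ (k ^ 2 - t / 4) * t * z t ^ 2 :=
    mul_nonneg (mul_nonneg (by linarith) h0) (sq_nonneg _)
  linarith

lemma en_le2 (b k : ℝ) (hb : 1 ≤ b) (hk : k = b ^ 3)
    (z zd v : ℝ → ℝ) (hz : ∀ t, HasDerivAt z (zd t) t)
    (hv : ∀ t, v t = z t + t * zd t) (hv' : ∀ t, HasDerivAt v ((t / 4 - k ^ 2) * z t) t)
    (hv0 : v 0 ^ 2 = (k ^ 2) ^ 2) (t : ℝ) (h0 : 2 * k ^ 2 ≤ t) (h1 : t ≤ 4 * k ^ 2 - 2 * b ^ 2) :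
    v t ^ 2 + (k ^ 2 - t / 4) * t * z t ^ 2 ≤ 2 * c1 ^ 2 * b ^ 2 * (k ^ 2 - t / 4) := by
  have hk1 : 1 ≤ k := by rw [hk]; exact one_le_pow₀ hb
  have hk2 : 1 ≤ k ^ 2 := one_le_pow₀ hk1
  have ht0 : 0 < t := by linarith
  have hb2 : 1 ≤ b ^ 2 := one_le_pow₀ hb
  have J := Jbound b k hb hk z zd v hz hv hv' hv0 t (by
    refine le_trans ?_ h0
    rw [div_le_iff₀ (by positivity)]; nlinarith) h1
  have f1 : b ^ 2 / 2 ≤ k ^ 2 - t / 4 := by linarith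
  have f0 : 0 < k ^ 2 - t / 4 := by linarith
  have A2 : √t ^ 2 = t := Real.sq_sqrt ht0.le
  have B2 : √(k ^ 2 - t / 4) ^ 2 = k ^ 2 - t / 4 := Real.sq_sqrt f0.le
  have Ap : 0 < √t := Real.sqrt_pos.2 ht0
  have Bp : 0 < √(k ^ 2 - t / 4) := Real.sqrt_pos.2 f0
  have c1p := c1_pos
  set A := √t
  set B := √(k ^ 2 - t / 4)
  have hAk : k ≤ A := by
    apply le_of_sq_le_sq _ Ap.le; rw [A2]; linarith
  have hBb : b ≤ 2 * B := by
    apply le_of_sq_le_sq _ (by positivity); nlinarith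
  have n2 : 0 ≤ v t ^ 2 + (k ^ 2 - t / 4) * t * z t ^ 2 := by positivity
  have e : A / B * v t ^ 2 + A ^ 3 * B * z t ^ 2 =
      A / B * (v t ^ 2 + (k ^ 2 - t / 4) * t * z t ^ 2) := by
    have : (k ^ 2 - t / 4) * t = B ^ 2 * A ^ 2 := by rw [A2, B2]
    rw [this]; field_simp
  rw [e] at J
  have h4 : k / B * (v t ^ 2 + (k ^ 2 - t / 4) * t * z t ^ 2) ≤ (k / B) * (c1 ^ 2 * k * B) := by
    calc _ ≤ A / B * (v t ^ 2 + (k ^ 2 - t / 4) * t * z t ^ 2) := by gcongr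
      _ ≤ _ := J
      _ = _ := by field_simp
  have h5 := le_of_mul_le_mul_left h4 (by positivity)
  refine h5.trans ?_
  rw [← B2]
  calc c1 ^ 2 * k * B = c1 ^ 2 * b ^ 2 * B * b := by rw [hk]; ring
    _ ≤ c1 ^ 2 * b ^ 2 * B * (2 * B) := by gcongr
    _ = _ := by ring

lemma G_one (b k : ℝ) (hb : 1 ≤ b) (hk : k = b ^ 3)
    (z zd v : ℝ → ℝ) (hz : ∀ t, HasDerivAt z (zd t) t)
    (hv : ∀ t, v t = z t + t * zd t) (hv' : ∀ t, HasDerivAt v ((t / 4 - k ^ 2) * z t) t)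
    (hv0 : v 0 ^ 2 = (k ^ 2) ^ 2) (S : ℝ → ℝ) (hS : ∀ t, HasDerivAt S (-z t / 2) t)
    (hS0 : 4 * k ^ 2 * S 0 - 2 * v 0 = 2 * k ^ 2) (t : ℝ) (h0 : 0 ≤ t) (h1 : t ≤ 2 * k ^ 2) :
    |S t - v t / (2 * (k ^ 2 - t / 4))| ≤ 3 / 2 := by
  have hk1 : 1 ≤ k := by rw [hk]; exact one_le_pow₀ hb
  have hk2 : 1 ≤ k ^ 2 := one_le_pow₀ hk1
  have := dom_mvt _ _ (fun t => t / (2 * k ^ 2)) (fun _ => 1 / (2 * k ^ 2)) 0 t h0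
    (fun s hs => hasDeriv_G (k ^ 2) z v S hv' hS s (by linarith [hs.2]))
    (fun s hs => (hasDerivAt_id s).div_const _) (fun s hs => by
      have hvs := v_le b k hb hk z zd v hz hv hv' hv0 s hs.1 (by linarith [hs.2])
      have : k ^ 2 / 2 ≤ k ^ 2 - s / 4 := by linarith [hs.2]
      rw [abs_div, abs_neg, abs_of_pos (a := 8 * (k ^ 2 - s / 4) ^ 2)
        (by have : 0 < k ^ 2 - s / 4 := by linarith
            positivity)]
      calc |v s| / (8 * (k ^ 2 - s / 4) ^ 2) ≤ k ^ 2 / (8 * (k ^ 2 / 2) ^ 2) := by gcongr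
        _ = _ := by field_simp; norm_num)
  have e0 : S 0 - v 0 / (2 * (k ^ 2 - 0 / 4)) = 1 / 2 := by
    simp only [zero_div, sub_zero]
    field_simp; linarith
  have e1 : t / (2 * k ^ 2) ≤ 1 := by rw [div_le_one (by positivity)]; exact h1
  rw [e0] at this
  simp only [zero_div, sub_zero] at this
  rw [abs_le] at this ⊢
  constructor <;> linarith

lemma S_two (b k : ℝ) (hb : 1 ≤ b) (hk : k = b ^ 3)
    (z zd v : ℝ → ℝ) (hz : ∀ t, HasDerivAt z (zd t) t)
    (hv : ∀ t, v t = z t + t * zd t) (hv' : ∀ t, HasDerivAt v ((t / 4 - k ^ 2) * z t) t)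
    (hv0 : v 0 ^ 2 = (k ^ 2) ^ 2) (S : ℝ → ℝ) (hS : ∀ t, HasDerivAt S (-z t / 2) t)
    (hS0 : 4 * k ^ 2 * S 0 - 2 * v 0 = 2 * k ^ 2) (t : ℝ) (h0 : 2 * k ^ 2 ≤ t) (h1 : t ≤ 4 * k ^ 2 - 2 * b ^ 2) :
    |S t| ≤ 3 / 2 + 6 * c1 := by
  have hk1 : 1 ≤ k := by rw [hk]; exact one_le_pow₀ hb
  have hk2 : 1 ≤ k ^ 2 := one_le_pow₀ hk1
  have hb2 : 1 ≤ b ^ 2 := one_le_pow₀ hb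
  have c1p := c1_pos
  have hvB : ∀ s, 2 * k ^ 2 ≤ s → s ≤ t → |v s| ≤ 2 * c1 * b * √(k ^ 2 - s / 4) := by
    intro s h2 h3
    have f0 : 0 < k ^ 2 - s / 4 := by linarith
    have := en_le2 b k hb hk z zd v hz hv hv' hv0 s h2 (by linarith)
    apply abs_le_of_sq_le_sq _ (by positivity)
    have e : (2 * c1 * b * √(k ^ 2 - s / 4)) ^ 2 = 4 * c1 ^ 2 * b ^ 2 * (k ^ 2 - s / 4) := by
      rw [mul_pow, Real.sq_sqrt f0.le]; ring
    rw [e]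
    have n1 : 0 ≤ (k ^ 2 - s / 4) * s * z s ^ 2 :=
      mul_nonneg (mul_nonneg f0.le (by linarith)) (sq_nonneg _)
    have n2 : 0 ≤ c1 ^ 2 * b ^ 2 * (k ^ 2 - s / 4) := by positivity
    linarith
  have g1 := G_one b k hb hk z zd v hz hv hv' hv0 S hS hS0 (2 * k ^ 2) (by positivity) le_rfl
  have g2 := dom_mvt _ _ (fun t => 2 * c1 * b / √(k ^ 2 - t / 4))
    (fun t => 2 * c1 * b / (8 * √(k ^ 2 - t / 4) ^ 3)) (2 * k ^ 2) t h0
    (fun s hs => hasDeriv_G (k ^ 2) z v S hv' hS s (by linarith [hs.2]))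
    (fun s hs => by
      have f0 : 0 < k ^ 2 - s / 4 := by linarith [hs.2]
      have Bp : 0 < √(k ^ 2 - s / 4) := Real.sqrt_pos.2 f0
      refine ((hasDerivAt_const s (2 * c1 * b)).div (hasDeriv_B (k ^ 2) s f0) Bp.ne').congr_deriv ?_
      generalize √(k ^ 2 - s / 4) = B at *
      field_simp
      ring)
    (fun s hs => by
      have f0 : 0 < k ^ 2 - s / 4 := by linarith [hs.2]
      have Bp : 0 < √(k ^ 2 - s / 4) := Real.sqrt_pos.2 f0
      have B2 : √(k ^ 2 - s / 4) ^ 2 = k ^ 2 - s / 4 := Real.sq_sqrt f0.le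
      have hvs := hvB s hs.1 hs.2
      generalize √(k ^ 2 - s / 4) = B at *
      rw [← B2]
      rw [abs_div, abs_neg, abs_of_pos (a := 8 * (B ^ 2) ^ 2) (by positivity)]
      calc |v s| / (8 * (B ^ 2) ^ 2) ≤ (2 * c1 * b * B) / (8 * (B ^ 2) ^ 2) := by gcongr
        _ = _ := by field_simp)
  have f0 : 0 < k ^ 2 - t / 4 := by linarith
  have Bp : 0 < √(k ^ 2 - t / 4) := Real.sqrt_pos.2 f0
  have B2 : √(k ^ 2 - t / 4) ^ 2 = k ^ 2 - t / 4 := Real.sq_sqrt f0.le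
  have hvt := hvB t h0 le_rfl
  have n3 : 0 ≤ 2 * c1 * b / √(k ^ 2 - 2 * k ^ 2 / 4) := by positivity
  have hBb : b ≤ 2 * √(k ^ 2 - t / 4) := by
    apply le_of_sq_le_sq _ (by positivity); nlinarith
  have n4 : 2 * c1 * b / √(k ^ 2 - t / 4) ≤ 4 * c1 := by
    rw [div_le_iff₀ Bp]; nlinarith
  have n5 : |v t / (2 * (k ^ 2 - t / 4))| ≤ 2 * c1 := by
    rw [abs_div, abs_of_pos (a := 2 * (k ^ 2 - t / 4)) (by positivity)]
    rw [div_le_iff₀ (by positivity), ← B2]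
    calc |v t| ≤ _ := hvt
      _ ≤ 2 * c1 * (2 * √(k ^ 2 - t / 4)) * √(k ^ 2 - t / 4) := by gcongr
      _ = _ := by ring
  rw [abs_le] at g1 g2 n5 ⊢
  constructor <;> linarith

lemma S_bound (b k : ℝ) (hb : 1 ≤ b) (hk : k = b ^ 3)
    (z zd v : ℝ → ℝ) (hz : ∀ t, HasDerivAt z (zd t) t)
    (hv : ∀ t, v t = z t + t * zd t) (hv' : ∀ t, HasDerivAt v ((t / 4 - k ^ 2) * z t) t)
    (hv0 : v 0 ^ 2 = (k ^ 2) ^ 2) (S : ℝ → ℝ) (hS : ∀ t, HasDerivAt S (-z t / 2) t)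
    (hS0 : 4 * k ^ 2 * S 0 - 2 * v 0 = 2 * k ^ 2) (t : ℝ) (h0 : 0 ≤ t) (h1 : t ≤ 4 * k ^ 2) :
    |S t| ≤ 5 / 2 + 9 * c1 := by
  have hk1 : 1 ≤ k := by rw [hk]; exact one_le_pow₀ hb
  have hk2 : 1 ≤ k ^ 2 := one_le_pow₀ hk1
  have hb2 : 1 ≤ b ^ 2 := one_le_pow₀ hb
  have c1p := c1_pos
  have hbk : b ^ 2 ≤ k ^ 2 := by
    rw [hk, ← pow_mul]; exact pow_le_pow_right₀ hb (by norm_num)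
  rcases le_total t (2 * k ^ 2) with h2 | h2
  · have g1 := G_one b k hb hk z zd v hz hv hv' hv0 S hS hS0 t h0 h2
    have hvs := v_le b k hb hk z zd v hz hv hv' hv0 t h0 h1
    have : |v t / (2 * (k ^ 2 - t / 4))| ≤ 1 := by
      have : k ^ 2 / 2 ≤ k ^ 2 - t / 4 := by linarith
      rw [abs_div, abs_of_pos (a := 2 * (k ^ 2 - t / 4)) (by linarith)]
      rw [div_le_one (by linarith)]; linarith
    rw [abs_le] at g1 this ⊢
    constructor <;> linarith
  rcases le_total t (4 * k ^ 2 - 2 * b ^ 2) with h3 | h3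
  · have := S_two b k hb hk z zd v hz hv hv' hv0 S hS hS0 t h2 h3
    linarith
  have hs2 : 2 * k ^ 2 ≤ 4 * k ^ 2 - 2 * b ^ 2 := by linarith
  have hSs := S_two b k hb hk z zd v hz hv hv' hv0 S hS hS0 _ hs2 le_rfl
  have hens := en_le2 b k hb hk z zd v hz hv hv' hv0 _ hs2 le_rfl
  have hanti := energy_anti (k ^ 2) (by positivity) z zd v hz hv hv'
  set s := 4 * k ^ 2 - 2 * b ^ 2 with hs
  have hf : k ^ 2 - s / 4 = b ^ 2 / 2 := by rw [hs]; ring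
  have hE : v s ^ 2 + (k ^ 2 - s / 4) * s * z s ^ 2 ≤ (c1 * b ^ 2) ^ 2 := by
    refine hens.trans (le_of_eq ?_); rw [hf]; ring
  have hvr : ∀ r ∈ Set.Icc s t, |v r| ≤ c1 * b ^ 2 := by
    intro r hr
    apply abs_le_of_sq_le_sq _ (by positivity)
    have := hanti hr.1
    simp only at this
    have n1 : 0 ≤ (k ^ 2 - r / 4) * r * z r ^ 2 :=
      mul_nonneg (mul_nonneg (by linarith [hr.2]) (by linarith [hr.1])) (sq_nonneg _)
    linarith
  have hk6 : k ^ 2 = b ^ 6 := by rw [hk]; ring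
  have hszs : |s * z s| ≤ 3 * c1 * b ^ 4 := by
    apply abs_le_of_sq_le_sq _ (by positivity)
    rw [hf] at hE
    have m1 : s * z s ^ 2 ≤ 2 * c1 ^ 2 * b ^ 2 := by
      have : (b ^ 2 / 2) * (s * z s ^ 2) ≤ (b ^ 2 / 2) * (2 * c1 ^ 2 * b ^ 2) := by
        nlinarith [sq_nonneg (v s)]
      exact le_of_mul_le_mul_left this (by positivity)
    have m2 : s ≤ 4 * b ^ 6 := by rw [← hk6]; linarith
    have hsp : 0 ≤ s := by linarith
    calc (s * z s) ^ 2 = s * (s * z s ^ 2) := by ring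
      _ ≤ (4 * b ^ 6) * (2 * c1 ^ 2 * b ^ 2) := by gcongr
      _ = 8 * (c1 ^ 2 * b ^ 8) := by ring
      _ ≤ 9 * (c1 ^ 2 * b ^ 8) := by gcongr; norm_num
      _ = _ := by ring
  have htz : ∀ r ∈ Set.Icc s t, |r * z r| ≤ 5 * c1 * b ^ 4 := by
    intro r hr
    have := dom_mvt (fun r => r * z r) v (fun r => c1 * b ^ 2 * r) (fun _ => c1 * b ^ 2) s r hr.1
      (fun q _ => by
        refine ((hasDerivAt_id q).mul (hz q)).congr_deriv ?_
        rw [hv q]; simp)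
      (fun q _ => by simpa using (hasDerivAt_id q).const_mul (c1 * b ^ 2))
      (fun q hq => hvr q ⟨hq.1, hq.2.trans hr.2⟩)
    have hrs : r - s ≤ 2 * b ^ 2 := by rw [hs]; linarith [hr.2]
    have : c1 * b ^ 2 * r - c1 * b ^ 2 * s ≤ 2 * c1 * b ^ 4 := by
      calc _ = c1 * b ^ 2 * (r - s) := by ring
        _ ≤ c1 * b ^ 2 * (2 * b ^ 2) := by gcongr
        _ = _ := by ring
    rw [abs_le] at *
    constructor <;> linarith
  have hzr : ∀ r ∈ Set.Icc s t, |z r| ≤ 5 / 2 * c1 / b ^ 2 := by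
    intro r hr
    have h := htz r hr
    have hr0 : 2 * b ^ 6 ≤ r := by rw [← hk6]; linarith [hr.1]
    have hrp : 0 < r := lt_of_lt_of_le (by positivity) hr0
    rw [abs_mul, abs_of_pos hrp] at h
    have : (2 * b ^ 6) * |z r| ≤ (2 * b ^ 6) * (5 / 2 * c1 / b ^ 2) := by
      calc _ ≤ r * |z r| := by gcongr
        _ ≤ _ := h
        _ = _ := by field_simp
    exact le_of_mul_le_mul_left this (by positivity)
  have := dom_mvt S _ (fun r => 5 / 4 * c1 / b ^ 2 * r) (fun _ => 5 / 4 * c1 / b ^ 2) s t h3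
      (fun q _ => hS q)
      (fun q _ => by simpa using (hasDerivAt_id q).const_mul (5 / 4 * c1 / b ^ 2))
      (fun q hq => by
        have := hzr q hq
        rw [abs_div, abs_neg, abs_of_pos (a := (2 : ℝ)) (by norm_num)]
        have e : 5 / 4 * c1 / b ^ 2 = (5 / 2 * c1 / b ^ 2) / 2 := by ring
        rw [e]; gcongr)
  have h5 : 5 / 4 * c1 / b ^ 2 * t - 5 / 4 * c1 / b ^ 2 * s ≤ 5 / 2 * c1 := by
    have hrs : t - s ≤ 2 * b ^ 2 := by rw [hs]; linarith
    calc _ = 5 / 4 * c1 / b ^ 2 * (t - s) := by ring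
        _ ≤ 5 / 4 * c1 / b ^ 2 * (2 * b ^ 2) := by gcongr
        _ = _ := by field_simp; norm_num
  rw [abs_le] at *
  constructor <;> linarith


noncomputable def Yl : ℕ → ℝ → ℝ
  | 0, _ => 0
  | 1, _ => 1
  | n + 2, t => (t / (n + 1) - 2) * Yl (n + 1) t - Yl n t

noncomputable def dYl : ℕ → ℝ → ℝ
  | 0, _ => 0
  | n + 1, t => Yl n t - dYl n t

lemma Yl_rec (n : ℕ) (t : ℝ) : Yl (n + 2) t = (t / (n + 1) - 2) * Yl (n + 1) t - Yl n t := by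
  rw [Yl]

lemma Yl_rec' (n : ℕ) (t : ℝ) :
    (n + 1) * Yl (n + 2) t = (t - 2 * (n + 1)) * Yl (n + 1) t - (n + 1) * Yl n t := by
  rw [Yl_rec]; field_simp

lemma dYl_rec (n : ℕ) (t : ℝ) : dYl (n + 1) t = Yl n t - dYl n t := by rw [dYl]

lemma t_dYl (n : ℕ) (t : ℝ) : t * dYl (n + 1) t = n * Yl (n + 1) t + (n + 1) * Yl n t := by
  induction n with
  | zero => simp [dYl, Yl]
  | succ n ih =>
    rw [dYl_rec]
    have := Yl_rec' n t
    push_cast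
    linear_combination -ih - this

lemma hasDeriv_Yl (n : ℕ) (t : ℝ) : HasDerivAt (Yl n) (dYl n t) t := by
  have : HasDerivAt (Yl n) (dYl n t) t ∧ HasDerivAt (Yl (n + 1)) (dYl (n + 1) t) t := by
    induction n with
    | zero =>
      constructor
      · have : Yl 0 = fun _ => 0 := by funext t; simp [Yl]
        rw [this]; simpa [dYl] using hasDerivAt_const t (0 : ℝ)
      · have : Yl 1 = fun _ => 1 := by funext t; simp [Yl]
        simp only [zero_add]
        rw [this]; simpa [dYl, Yl] using hasDerivAt_const t (1 : ℝ)
    | succ n ih =>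
      refine ⟨ih.2, ?_⟩
      have e : Yl (n + 1 + 1) = fun t => (t / (n + 1) - 2) * Yl (n + 1) t - Yl n t := by
        funext t; exact Yl_rec n t
      rw [e]
      refine (((((hasDerivAt_id t).div_const _).sub_const 2).mul ih.2).sub ih.1).congr_deriv ?_
      have h := t_dYl n t
      have h2 := dYl_rec n t
      rw [dYl_rec (n + 1)]
      simp only [id]
      field_simp
      linear_combination h - (n + 1) * h2
  exact this.1

lemma Yl_big (n : ℕ) (t : ℝ) (ht : 4 * (n : ℝ) ≤ t) : 0 ≤ Yl n t ∧ Yl n t ≤ Yl (n + 1) t := by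
  induction n with
  | zero => simp [Yl]
  | succ n ih =>
    push_cast at ht
    obtain ⟨h1, h2⟩ := ih (by linarith)
    refine ⟨h1.trans h2, ?_⟩
    rw [Yl_rec]
    have : 4 ≤ t / (n + 1) := by rw [le_div_iff₀ (by positivity)]; exact ht
    nlinarith

lemma Yl_zero (n : ℕ) : Yl n 0 = (-1) ^ (n + 1) * n := by
  have : Yl n 0 = (-1) ^ (n + 1) * n ∧ Yl (n + 1) 0 = (-1) ^ (n + 2) * (n + 1 : ℕ) := by
    induction n with
    | zero => simp [Yl]
    | succ n ih =>
      refine ⟨ih.2, ?_⟩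
      rw [Yl_rec, ih.1, ih.2]
      push_cast; ring
  exact this.1

noncomputable def Sf : ℕ → ℝ → ℝ
  | 0, t => Real.exp (-t / 2)
  | n + 1, t => Sf n t + Real.exp (-t / 2) * (Yl (n + 2) t + Yl (n + 1) t)

lemma Sf_rec (n : ℕ) (t : ℝ) :
    Sf (n + 1) t = Sf n t + Real.exp (-t / 2) * (Yl (n + 2) t + Yl (n + 1) t) := by rw [Sf]

lemma hasDeriv_e (t : ℝ) : HasDerivAt (fun t : ℝ => Real.exp (-t / 2)) (-Real.exp (-t / 2) / 2) t := by
  refine (((hasDerivAt_id t).neg.div_const 2).exp).congr_deriv ?_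
  simp; ring

lemma hasDeriv_Sf (n : ℕ) (t : ℝ) :
    HasDerivAt (Sf n) (-(Real.exp (-t / 2) * Yl (n + 1) t) / 2) t := by
  induction n with
  | zero =>
    have : Sf 0 = fun t => Real.exp (-t / 2) := by funext t; rw [Sf]
    rw [this]; simpa [Yl] using hasDeriv_e t
  | succ n ih =>
    have e : Sf (n + 1) = fun t => Sf n t + Real.exp (-t / 2) * (Yl (n + 2) t + Yl (n + 1) t) := by
      funext t; exact Sf_rec n t
    rw [e]
    refine (ih.add ((hasDeriv_e t).mul ((hasDeriv_Yl (n + 2) t).add (hasDeriv_Yl (n + 1) t)))).congr_deriv ?_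
    simp only [Pi.add_apply]
    rw [dYl_rec (n + 1)]
    ring

lemma Sf_zero (n : ℕ) : Sf n 0 = (1 + (-1) ^ n) / 2 := by
  induction n with
  | zero => simp [Sf]
  | succ n ih =>
    rw [Sf_rec, ih, Yl_zero, Yl_zero]
    simp; ring

noncomputable def zl (n : ℕ) (t : ℝ) : ℝ := Real.exp (-t / 2) * Yl (n + 1) t
noncomputable def zdl (n : ℕ) (t : ℝ) : ℝ := Real.exp (-t / 2) * (dYl (n + 1) t - Yl (n + 1) t / 2)
noncomputable def vl (n : ℕ) (t : ℝ) : ℝ :=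
  Real.exp (-t / 2) * ((n + 1 - t / 2) * Yl (n + 1) t + (n + 1) * Yl n t)

lemma zl_deriv (n : ℕ) (t : ℝ) : HasDerivAt (zl n) (zdl n t) t := by
  refine ((hasDeriv_e t).mul (hasDeriv_Yl (n + 1) t)).congr_deriv ?_
  rw [zdl]; ring

lemma vl_eq (n : ℕ) (t : ℝ) : vl n t = zl n t + t * zdl n t := by
  rw [vl, zl, zdl]
  linear_combination -Real.exp (-t / 2) * t_dYl n t

lemma vl_deriv (n : ℕ) (t : ℝ) : HasDerivAt (vl n) ((t / 4 - (n + 1)) * zl n t) t := by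
  have h1 : HasDerivAt (fun t : ℝ => (n + 1 - t / 2 : ℝ)) (0 - 1 / 2) t :=
    (hasDerivAt_const t _).sub ((hasDerivAt_id t).div_const 2)
  refine ((hasDeriv_e t).mul ((h1.mul (hasDeriv_Yl (n + 1) t)).add
    ((hasDeriv_Yl n t).const_mul (n + 1 : ℝ)))).congr_deriv ?_
  simp only [Pi.add_apply, Pi.mul_apply]
  rw [zl]
  have h := t_dYl n t
  have h2 := dYl_rec n t
  linear_combination Real.exp (-t / 2) * (-h / 2 + (n + 1) * h2)

noncomputable def C0 : ℝ := 5 / 2 + 9 * c1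

lemma Sf_bound (n : ℕ) (t : ℝ) (ht : 0 ≤ t) : |Sf n t| ≤ C0 := by
  have hn : (0 : ℝ) < n + 1 := by positivity
  have small : ∀ t, 0 ≤ t → t ≤ 4 * (n + 1 : ℝ) → |Sf n t| ≤ C0 := by
    intro t ht ht1
    obtain ⟨b, hb, hb6⟩ : ∃ b : ℝ, 1 ≤ b ∧ (b ^ 3) ^ 2 = n + 1 := by
      refine ⟨(n + 1 : ℝ) ^ ((1 : ℝ) / 6), ?_, ?_⟩
      · apply Real.one_le_rpow (by linarith [(Nat.cast_nonneg n : (0 : ℝ) ≤ n)]) (by norm_num)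
      · rw [← pow_mul, ← Real.rpow_natCast, ← Real.rpow_mul hn.le]; norm_num
    refine S_bound b (b ^ 3) hb rfl (zl n) (zdl n) (vl n) (zl_deriv n) (vl_eq n)
      (fun t => by rw [hb6]; exact vl_deriv n t) ?_ (Sf n) (fun t => hasDeriv_Sf n t) ?_ t ht
      (by rw [hb6]; exact ht1)
    · rw [hb6, vl, Yl_zero, Yl_zero]
      have : ((-1 : ℝ) ^ n) ^ 2 = 1 := by rw [← pow_mul, mul_comm, pow_mul]; simp
      simp only [neg_zero, zero_div, Real.exp_zero, pow_succ]
      push_cast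
      linear_combination ((n : ℝ) + 1) ^ 2 * this
    · rw [hb6, vl, Yl_zero, Yl_zero, Sf_zero]
      simp only [neg_zero, zero_div, Real.exp_zero, pow_succ]
      push_cast
      ring
  rcases le_total t (4 * (n + 1 : ℝ)) with h | h
  · exact small t ht h
  · have h4 := small (4 * (n + 1 : ℝ)) (by positivity) le_rfl
    have anti : AntitoneOn (Sf n) (Set.Ici (4 * (n + 1 : ℝ))) := by
      apply antitoneOn_of_deriv_nonpos (convex_Ici _)
      · intro t ht; exact (hasDeriv_Sf n t).continuousAt.continuousWithinAt
      · intro t ht; exact (hasDeriv_Sf n t).differentiableAt.differentiableWithinAt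
      · intro t ht
        have ht' : 4 * (n + 1 : ℝ) ≤ t := interior_subset ht
        rw [(hasDeriv_Sf n t).deriv]
        have := (Yl_big (n + 1) t (by push_cast; exact ht')).1
        have := mul_nonneg (Real.exp_pos (-t / 2)).le this
        linarith
    have h5 := anti (Set.self_mem_Ici) h h
    have pos : ∀ m : ℕ, (m : ℝ) ≤ n + 1 → 0 ≤ Sf m t := by
      intro m hm
      induction m with
      | zero => rw [Sf]; positivity
      | succ m ih =>
        push_cast at hm
        rw [Sf_rec]
        obtain ⟨y1, y2⟩ := Yl_big (m + 1) t (by push_cast; linarith)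
        have := ih (by linarith)
        have e := Real.exp_pos (-t / 2)
        have : 0 ≤ Real.exp (-t / 2) * (Yl (m + 2) t + Yl (m + 1) t) :=
          mul_nonneg e.le (add_nonneg (y1.trans y2) y1)
        linarith
    have p := pos n (by linarith)
    rw [abs_of_nonneg p]
    exact h5.trans ((le_abs_self _).trans h4)

lemma Sf_ode (t : ℝ) : qps * PowerSeries.derivative ℝ (PowerSeries.mk (fun n => Sf n t)) =
    cps 2 t * PowerSeries.mk (fun n => Sf n t) := by
  have s0 : Sf 0 t = Real.exp (-t / 2) := by rw [Sf]
  have s1 := Sf_rec 0 t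
  have s2 := Sf_rec 1 t
  have y2 := Yl_rec' 0 t
  have y3 := Yl_rec' 1 t
  have y0 : Yl 0 t = 0 := by simp [Yl]
  have y1 : Yl 1 t = 1 := by simp [Yl]
  norm_num at s1 s2 y2 y3
  simp only [y0, y1] at s1 s2 y2 y3
  apply ps_ode
  · simp only [s1, s0]
    linear_combination Real.exp (-t / 2) * y2
  · rw [s2, s1, s0]
    linear_combination Real.exp (-t / 2) * (y3 + y2)
  · intro n
    have a1 := Sf_rec n t
    have a2 := Sf_rec (n + 1) t
    have a3 := Sf_rec (n + 2) t
    have b1 := Yl_rec' (n + 1) t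
    have b2 := Yl_rec' (n + 2) t
    push_cast at b1 b2
    linear_combination (n + 3) * a3 + (2 * n + 5 - t) * a2 + (n + 2) * a1 + Real.exp (-t / 2) * (b1 + b2)


lemma prod_eq (m : ℕ) (x : Fin (m + 2) → ℝ) :
    ∏ k, Mps (x k) = PowerSeries.C (Real.pi⁻¹) *
      (Mps 0 ^ m * PowerSeries.mk (fun n => Sf n (2 * ∑ k, x k ^ 2))) := by
  have hF := prod_ode Finset.univ (fun k => Mps (x k)) (fun _ => 1) (fun k => 2 * x k ^ 2)
    (fun k => Mps_ode (x k))
  have hP := prod_ode (Finset.range m) (fun _ => Mps 0) (fun _ => 1) (fun _ => 2 * 0 ^ 2)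
    (fun k => Mps_ode 0)
  have hS := Sf_ode (2 * ∑ k, x k ^ 2)
  simp only [Finset.prod_const, Finset.card_range, Finset.sum_const, Finset.card_univ,
    Fintype.card_fin, nsmul_eq_mul, mul_one, ← Finset.mul_sum] at hF hP
  have hc : cps ((m + 2 : ℕ) : ℝ) (2 * ∑ k, x k ^ 2) =
      cps (m : ℝ) (m * (2 * 0 ^ 2)) + cps 2 (2 * ∑ k, x k ^ 2) := by
    rw [cps_add]; push_cast; congr 1; ring
  apply ps_unique _ _ qps _ qps_ne hF
  · rw [hc]
    have hC : ∀ G : PowerSeries ℝ, PowerSeries.derivative ℝ (PowerSeries.C (Real.pi⁻¹) * G) =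
        PowerSeries.C (Real.pi⁻¹) * PowerSeries.derivative ℝ G := by
      intro G
      rw [← PowerSeries.smul_eq_C_mul, ← PowerSeries.smul_eq_C_mul, Derivation.map_smul]
    rw [hC, Derivation.leibniz]
    simp only [smul_eq_mul]
    linear_combination PowerSeries.C (Real.pi⁻¹) *
      ((Mps 0 ^ m) * hS + PowerSeries.mk (fun n => Sf n (2 * ∑ k, x k ^ 2)) * hP)
  · have e : PowerSeries.constantCoeff (PowerSeries.mk (fun n => Sf n (2 * ∑ k, x k ^ 2))) =
        Real.exp (-(∑ k, x k ^ 2)) := by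
      rw [← PowerSeries.coeff_zero_eq_constantCoeff_apply, PowerSeries.coeff_mk, Sf]
      congr 1; ring
    simp only [map_mul, map_pow, map_prod, M0, e, PowerSeries.constantCoeff_C]
    rw [Finset.prod_div_distrib, ← Real.exp_sum, Finset.sum_neg_distrib]
    simp only [Finset.prod_const, Finset.card_univ, Fintype.card_fin]
    have hp : √Real.pi ^ 2 = Real.pi := Real.sq_sqrt Real.pi_pos.le
    have hp0 : √Real.pi ≠ 0 := (Real.sqrt_pos.2 Real.pi_pos).ne'
    nth_rw 2 [← hp]
    simp
    field_simp
    ring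
  · have e : PowerSeries.constantCoeff (PowerSeries.mk (fun n => Sf n (2 * ∑ k, x k ^ 2))) =
        Real.exp (-(∑ k, x k ^ 2)) := by
      rw [← PowerSeries.coeff_zero_eq_constantCoeff_apply, PowerSeries.coeff_mk, Sf]
      congr 1; ring
    simp only [map_mul, map_pow, M0, e, PowerSeries.constantCoeff_C]
    positivity

lemma C0_pos : 0 < C0 := by have := c1_pos; unfold C0; positivity

lemma eSpec_le (m n : ℕ) (x : Fin (m + 2) → ℝ) :
    eSpec (m + 2) n x ≤ Real.pi⁻¹ * (C0 * (2 * √(n + 1)) ^ m) := by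
  have hC := C0_pos
  rw [eSpec_coeff, prod_eq, PowerSeries.coeff_C_mul, PowerSeries.coeff_mul]
  obtain ⟨h1, h2⟩ := pow_sum m n
  gcongr
  rw [Finset.Nat.sum_antidiagonal_eq_sum_range_succ
    (fun i j => PowerSeries.coeff i (Mps 0 ^ m) * PowerSeries.coeff j (PowerSeries.mk (fun n => Sf n (2 * ∑ k, x k ^ 2))))]
  calc _ ≤ ∑ j ∈ Finset.range (n + 1), PowerSeries.coeff j (Mps 0 ^ m) * C0 := by
        apply Finset.sum_le_sum
        intro i _
        apply mul_le_mul_of_nonneg_left _ (h1 i)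
        rw [PowerSeries.coeff_mk]
        exact (le_abs_self _).trans (Sf_bound _ _ (by positivity))
    _ = C0 * ∑ j ∈ Finset.range (n + 1), PowerSeries.coeff j (Mps 0 ^ m) := by
        rw [← Finset.sum_mul, mul_comm]
    _ ≤ _ := by gcongr

lemma f_le (d : ℕ) (hd : 2 ≤ d) : ∃ K : ℝ, 1 ≤ K ∧ ∀ n x,
    eSpec d n x / Ddim d n * (1 + n : ℝ) ^ ((d : ℝ) / 2) ≤ K := by
  obtain ⟨m, rfl⟩ : ∃ m, d = m + 2 := ⟨d - 2, by omega⟩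
  refine ⟨max 1 (Real.pi⁻¹ * (C0 * 2 ^ m) * (m + 1).factorial), le_max_left _ _, fun n x => ?_⟩
  refine le_trans ?_ (le_max_right _ _)
  have hC := C0_pos
  have hD : ((n : ℝ) + 1) ^ (m + 1) ≤ (m + 1).factorial * Ddim (m + 2) n := by
    have := Nat.pow_le_choose (α := ℝ) (m + 1) (n + (m + 2) - 1)
    have e : n + (m + 2) - 1 + 1 - (m + 1) = n + 1 := by omega
    rw [e] at this
    unfold Ddim
    rw [show m + 2 - 1 = m + 1 by omega]
    push_cast at this ⊢
    rw [div_le_iff₀ (by positivity), mul_comm] at this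
    exact this
  have hDp : (0 : ℝ) < Ddim (m + 2) n := by
    have : 0 < ((n : ℝ) + 1) ^ (m + 1) := by positivity
    have h2 : (0 : ℝ) < (m + 1).factorial := by positivity
    by_contra hc
    push Not at hc
    nlinarith
  have hr : (1 + n : ℝ) ^ (((m + 2 : ℕ) : ℝ) / 2) = √(n + 1) ^ (m + 2) := by
    rw [Real.sqrt_eq_rpow, ← Real.rpow_natCast, ← Real.rpow_mul (by positivity), add_comm]
    congr 1; ring
  rw [hr, div_mul_eq_mul_div, div_le_iff₀ hDp]
  have s2 : √((n : ℝ) + 1) ^ 2 = n + 1 := Real.sq_sqrt (by positivity)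
  calc _ ≤ (Real.pi⁻¹ * (C0 * (2 * √(n + 1)) ^ m)) * √(n + 1) ^ (m + 2) := by
        gcongr; exact eSpec_le m n x
    _ = Real.pi⁻¹ * (C0 * 2 ^ m) * (√((n : ℝ) + 1) ^ 2) ^ (m + 1) := by ring
    _ = Real.pi⁻¹ * (C0 * 2 ^ m) * ((n : ℝ) + 1) ^ (m + 1) := by rw [s2]
    _ ≤ Real.pi⁻¹ * (C0 * 2 ^ m) * ((m + 1).factorial * Ddim (m + 2) n) := by gcongr
    _ = _ := by ring


lemma tsum_jensen (w g : ℕ → ℝ≥0∞) (q : ℝ) (hq : 1 ≤ q) :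
    (∑' n, w n * g n) ^ q ≤ (∑' n, w n) ^ (q - 1) * ∑' n, w n * g n ^ q := by
  have hq0 : 0 < q := by linarith
  have h1 : ∑' n, w n * g n ≤ (∑' n, w n) ^ (1 - q⁻¹) * (∑' n, w n * g n ^ q) ^ q⁻¹ := by
    apply ENNReal.tsum_le_of_sum_range_le
    intro n
    refine (ENNReal.inner_le_weight_mul_Lp_of_nonneg _ hq _ _).trans ?_
    have : 0 ≤ 1 - q⁻¹ := by
      have := inv_le_one_of_one_le₀ hq; linarith
    gcongr
    · exact ENNReal.sum_le_tsum _
    · exact ENNReal.sum_le_tsum _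
  calc _ ≤ ((∑' n, w n) ^ (1 - q⁻¹) * (∑' n, w n * g n ^ q) ^ q⁻¹) ^ q := by gcongr
    _ = _ := by
      rw [ENNReal.mul_rpow_of_nonneg _ _ hq0.le, ← ENNReal.rpow_mul, ← ENNReal.rpow_mul]
      rw [inv_mul_cancel₀ hq0.ne', ENNReal.rpow_one]
      congr 2; field_simp

lemma Ddim_pos (d n : ℕ) : 0 < Ddim d n := Nat.choose_pos (by omega)

lemma lint_F (d n : ℕ) (hd : 2 ≤ d) :
    ∫⁻ x : Fin d → ℝ, ENNReal.ofReal (eSpec d n x / Ddim d n) = 1 := by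
  obtain ⟨h1, h2⟩ := int_eSpec d n hd
  have hD : (0 : ℝ) < Ddim d n := by exact_mod_cast Ddim_pos d n
  rw [← ofReal_integral_eq_lintegral_ofReal (h1.div_const _)
    (Filter.Eventually.of_forall fun x => div_nonneg (eSpec_nonneg d n x) hD.le)]
  rw [integral_div, h2, div_self hD.ne', ENNReal.ofReal_one]

lemma main_bound (d : ℕ) (hd : 2 ≤ d) (p : ℝ) (hp : 2 ≤ p) :
    ∃ C : ℝ, 1 ≤ C ∧
      ∀ c : ℕ → ℝ, 
        hermitePLnorm d p c
            ≤ ENNReal.ofReal C *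
              (∑' n : ℕ, ((1 + n : ℕ) : ℝ≥0∞) ^ (-(d : ℝ) * (1 / 2 - 1 / p)) *
                  ENNReal.ofReal ((c n) ^ 2)) ^ (1 / 2 : ℝ) := by
  obtain ⟨K, hK1, hK⟩ := f_le d hd
  have hK0 : 0 < K := by linarith
  have hp0 : 0 < p := by linarith
  refine ⟨(K ^ (p / 2 - 1)) ^ (1 / p), ?_, fun c => ?_⟩
  · exact Real.one_le_rpow (Real.one_le_rpow hK1 (by linarith)) (by positivity)
  set w : ℕ → ℝ≥0∞ := fun n => ((1 + n : ℕ) : ℝ≥0∞) ^ (-(d : ℝ) * (1 / 2 - 1 / p)) *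
                  ENNReal.ofReal ((c n) ^ 2) with hw
  set F : ℕ → (Fin d → ℝ) → ℝ≥0∞ := fun n x => ENNReal.ofReal (eSpec d n x / Ddim d n) with hF
  have hFm : ∀ n, Measurable (F n) := fun n =>
    ENNReal.measurable_ofReal.comp ((cont_eSpec d n).measurable.div_const _)
  have hn0 : ∀ n : ℕ, ((1 + n : ℕ) : ℝ≥0∞) ≠ 0 := fun n => by
    rw [Nat.cast_ne_zero]; omega
  have hnt : ∀ n : ℕ, ((1 + n : ℕ) : ℝ≥0∞) ≠ ⊤ := fun n => ENNReal.natCast_ne_top _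
  have hfac : ∀ n x, ENNReal.ofReal ((c n) ^ 2 * eSpec d n x / (Ddim d n)) =
      w n * (((1 + n : ℕ) : ℝ≥0∞) ^ ((d : ℝ) * (1 / 2 - 1 / p)) * F n x) := by
    intro n x
    have e : ((1 + n : ℕ) : ℝ≥0∞) ^ (-(d : ℝ) * (1 / 2 - 1 / p)) *
        ((1 + n : ℕ) : ℝ≥0∞) ^ ((d : ℝ) * (1 / 2 - 1 / p)) = 1 := by
      rw [← ENNReal.rpow_add _ _ (hn0 n) (hnt n)]
      rw [show -(d : ℝ) * (1 / 2 - 1 / p) + (d : ℝ) * (1 / 2 - 1 / p) = 0 by ring, ENNReal.rpow_zero]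
    rw [mul_div_assoc, ENNReal.ofReal_mul (sq_nonneg _)]
    calc _ = (((1 + n : ℕ) : ℝ≥0∞) ^ (-(d : ℝ) * (1 / 2 - 1 / p)) *
        ((1 + n : ℕ) : ℝ≥0∞) ^ ((d : ℝ) * (1 / 2 - 1 / p))) * (ENNReal.ofReal (c n ^ 2) * F n x) := by
          rw [e, one_mul]
      _ = _ := by simp only [hw]; ring
  have hq1 : 0 ≤ p / 2 - 1 := by linarith
  have hg : ∀ n x, (((1 + n : ℕ) : ℝ≥0∞) ^ ((d : ℝ) * (1 / 2 - 1 / p)) * F n x) ^ (p / 2) ≤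
      ENNReal.ofReal K ^ (p / 2 - 1) * F n x := by
    intro n x
    have e1 : (d : ℝ) * (1 / 2 - 1 / p) * (p / 2) = (d / 2 : ℝ) * (p / 2 - 1) := by
      field_simp
    rw [ENNReal.mul_rpow_of_nonneg _ _ (by positivity), ← ENNReal.rpow_mul, e1, ENNReal.rpow_mul]
    have e2 : F n x ^ (p / 2) = F n x ^ (p / 2 - 1) * F n x := by
      conv_rhs => rw [← ENNReal.rpow_one (F n x), ← ENNReal.rpow_mul, one_mul]
      rw [← ENNReal.rpow_add_of_nonneg _ _ hq1 zero_le_one]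
      congr 1; ring
    rw [e2, ← mul_assoc, ← ENNReal.mul_rpow_of_nonneg _ _ hq1]
    gcongr
    have e3 : ((1 + n : ℕ) : ℝ≥0∞) ^ ((d : ℝ) / 2) = ENNReal.ofReal ((1 + n : ℝ) ^ ((d : ℝ) / 2)) := by
      rw [← ENNReal.ofReal_rpow_of_pos (by positivity)]
      congr 1
      rw [← ENNReal.ofReal_natCast]; push_cast; rfl
    rw [e3, ← ENNReal.ofReal_mul (by positivity)]
    apply ENNReal.ofReal_le_ofReal
    rw [mul_comm]; exact hK n x
  unfold hermitePLnorm
  have hint : ∫⁻ x : Fin d → ℝ,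
      (∑' n : ℕ, ENNReal.ofReal ((c n) ^ 2 * eSpec d n x / (Ddim d n))) ^ (p / 2) ≤
      ENNReal.ofReal K ^ (p / 2 - 1) * (∑' n, w n) ^ (p / 2) := by
    calc _ ≤ ∫⁻ x : Fin d → ℝ, (∑' n, w n) ^ (p / 2 - 1) *
          (∑' n, w n * (ENNReal.ofReal K ^ (p / 2 - 1) * F n x)) := by
          apply lintegral_mono
          intro x
          simp only [hfac]
          refine (tsum_jensen _ _ (p / 2) (by linarith)).trans ?_
          gcongr
          exact hg _ x
      _ = (∑' n, w n) ^ (p / 2 - 1) *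
          (∑' n, w n * (ENNReal.ofReal K ^ (p / 2 - 1) * 1)) := by
          rw [lintegral_const_mul]
          · congr 1
            rw [lintegral_tsum]
            · congr 1; funext n
              rw [lintegral_const_mul _ ((hFm n).const_mul _), lintegral_const_mul _ (hFm n), lint_F d n hd]
            · intro n; exact (((hFm n).const_mul _).const_mul _).aemeasurable
          · exact Measurable.tsum fun n => ((hFm n).const_mul _).const_mul _
      _ = ENNReal.ofReal K ^ (p / 2 - 1) * ((∑' n, w n) ^ (p / 2 - 1) * (∑' n, w n)) := by
          rw [ENNReal.tsum_mul_right, mul_one]; ring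
      _ = _ := by
          congr 1
          conv_lhs => rw [← ENNReal.rpow_one (∑' n, w n), ← ENNReal.rpow_mul, one_mul]
          rw [← ENNReal.rpow_add_of_nonneg _ _ hq1 zero_le_one]
          congr 1; ring
  calc _ ≤ (ENNReal.ofReal K ^ (p / 2 - 1) * (∑' n, w n) ^ (p / 2)) ^ (1 / p) := by gcongr
    _ = _ := by
      rw [ENNReal.mul_rpow_of_nonneg _ _ (by positivity), ENNReal.ofReal_rpow_of_pos hK0,
        ENNReal.ofReal_rpow_of_pos (by positivity), ← ENNReal.rpow_mul]
      congr 2; field_simp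

/-- Theorem 6.4, probabilistic Sobolev embedding
`ℋ^{−d(1/2−1/p)}(ℝ^d) ⊂ PL^p(ℝ^d, ⊕E_{d,n})` for the harmonic oscillator. -/
theorem stmt13 (d : ℕ) (hd : 2 ≤ d) (p : ℝ) (hp : 2 ≤ p) :
    ∃ C : ℝ, 1 ≤ C ∧
      ∀ c : ℕ → ℝ, (∀ n, 0 ≤ c n) →
        (hermitePLnorm d p c
            ≤ ENNReal.ofReal C *
              (∑' n : ℕ, ((1 + n : ℕ) : ℝ≥0∞) ^ (-(d : ℝ) * (1 / 2 - 1 / p)) *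
                  ENNReal.ofReal ((c n) ^ 2)) ^ (1 / 2 : ℝ)) ∧
        ((∑' n : ℕ, ((1 + n : ℕ) : ℝ≥0∞) ^ (-(d : ℝ) * (1 / 2 - 1 / p)) *
              ENNReal.ofReal ((c n) ^ 2)) < ⊤ →
          hermitePLnorm d p c < ⊤) := by
  obtain ⟨C, hC, h⟩ := main_bound d hd p hp
  refine ⟨C, hC, fun c _ => ⟨h c, fun hfin => lt_of_le_of_lt (h c) ?_⟩⟩
  exact ENNReal.mul_lt_top ENNReal.ofReal_lt_top
    (ENNReal.rpow_lt_top_of_nonneg (by norm_num) hfin.ne)
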